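/- Let C be a smooth projective plane curve of degree 4 (a smooth plane quartic) over a number field k. Then every quadratic geometric progression sequence on C is of finite length. -/

import Mathlib

open MvPolynomial

set_option synthInstance.maxHeartbeats 400000
set_option maxHeartbeats 1000000

noncomputable section

/-- `F` defines a smooth projective plane curve of degree `d` over `k`: it is homogeneous of
degree `d` and, over the algebraic closure of `k`, `F` and its partial derivatives have no
common nontrivial zero (the Jacobian criterion for smoothness of the plane curve `F = 0`). -/
def IsSmoothPlaneCurve {k : Type} [Field k] (d : ℕ) (F : MvPolynomial (Fin 3) k) : Prop :=
  F.IsHomogeneous d ∧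
    ∀ P : Fin 3 → AlgebraicClosure k, P ≠ 0 →
      ∃ i : Fin 3, eval P (map (algebraMap k (AlgebraicClosure k)) (pderiv i F)) ≠ 0

theorem isIntegral_natCast_of_int {L : Type*} [Ring L] (n : ℕ) : IsIntegral ℤ (n : L) := by
  simpa using isIntegral_algebraMap (R := ℤ) (A := L) (x := (n : ℤ))

/-- A Cauchy type bound for the roots of a monic polynomial over a field with an absolute value. -/
theorem AbsoluteValue.le_of_monic_root {L : Type*} [Field L] (ν : AbsoluteValue L ℝ)
    {p : Polynomial L} (hp : p.Monic) {E : ℝ} (h1 : 1 ≤ E) (hE : ∀ i, ν (p.coeff i) ≤ E) {w : L}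
    (hw : p.eval w = 0) : ν w ≤ E * (p.natDegree + 1) := by
  have hn0 : (0 : ℝ) ≤ p.natDegree := Nat.cast_nonneg _
  by_cases hle : ν w ≤ 1
  · nlinarith
  push Not at hle
  have hpos : 0 < p.natDegree := by
    rcases Nat.eq_zero_or_pos p.natDegree with h | h
    · rw [hp.natDegree_eq_zero.1 h] at hw
      simp at hw
    · exact h
  obtain ⟨n, hn⟩ := Nat.exists_eq_add_of_lt hpos
  rw [zero_add] at hn
  rw [hp.as_sum, Polynomial.eval_add, Polynomial.eval_finsetSum] at hw
  simp only [Polynomial.eval_mul, Polynomial.eval_C, Polynomial.eval_pow, Polynomial.eval_X] at hw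
  have key : ν w ^ (n + 1) ≤ (n + 1) * E * ν w ^ n := by
    rw [← map_pow, ← hn, eq_neg_of_add_eq_zero_left hw, map_neg_eq_map]
    refine (ν.sum_le _ _).trans ((Finset.sum_le_card_nsmul _ _ (E * ν w ^ n) fun i hi => ?_).trans ?_)
    · rw [map_mul, map_pow]
      refine mul_le_mul (hE i) (pow_le_pow_right₀ hle.le ?_) (by positivity) (by linarith)
      simp at hi; omega
    · rw [Finset.card_range, hn, nsmul_eq_mul]
      push_cast
      exact le_of_eq (by ring)
  rw [pow_succ'] at key
  have := le_of_mul_le_mul_right key (by positivity)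
  rw [hn]
  push_cast
  nlinarith

/-- An element annihilated by a monic polynomial with integral coefficients is integral. -/
theorem isIntegral_of_monic_root {L : Type*} [Field L] {p : Polynomial L} (hp : p.Monic)
    (h : ∀ i, IsIntegral ℤ (p.coeff i)) {w : L} (hw : p.eval w = 0) : IsIntegral ℤ w := by
  have hl : p ∈ Polynomial.lifts (algebraMap (integralClosure ℤ L) L) := by
    rw [Polynomial.lifts_iff_coeff_lifts]
    exact fun i => ⟨⟨p.coeff i, h i⟩, rfl⟩
  obtain ⟨q, hq, -, hqm⟩ := Polynomial.lifts_and_natDegree_eq_and_monic hl hp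
  refine isIntegral_trans (A := integralClosure ℤ L) w ⟨q, hqm, ?_⟩
  rwa [← Polynomial.eval_map, hq]

/-- The algebraic number `w` has denominator dividing `E`, and all its conjugates are bounded
by `E` in absolute value. -/
def SizeLE {L : Type*} [Field L] (E : ℕ) (w : L) : Prop :=
  0 < E ∧ IsIntegral ℤ ((E : L) * w) ∧ ∀ σ : L →+* ℂ, ‖σ w‖ ≤ E

namespace SizeLE

variable {L : Type*} [Field L] {E E' : ℕ} {w w' : L}

theorem mono_dvd (h : SizeLE E w) (hd : E ∣ E') (hE' : 0 < E') : SizeLE E' w := by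
  obtain ⟨c, rfl⟩ := hd
  refine ⟨hE', ?_, fun σ => (h.2.2 σ).trans ?_⟩
  · have : ((E * c : ℕ) : L) * w = (c : L) * ((E : L) * w) := by push_cast; ring
    rw [this]
    exact (isIntegral_natCast_of_int c).mul h.2.1
  · exact_mod_cast Nat.le_mul_of_pos_right E (Nat.pos_of_mul_pos_left hE')

theorem mul (h : SizeLE E w) (h' : SizeLE E' w') : SizeLE (E * E') (w * w') := by
  refine ⟨Nat.mul_pos h.1 h'.1, ?_, fun σ => ?_⟩
  · have : ((E * E' : ℕ) : L) * (w * w') = ((E : L) * w) * ((E' : L) * w') := by push_cast; ring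
    rw [this]
    exact h.2.1.mul h'.2.1
  · rw [map_mul, norm_mul]
    push_cast
    exact mul_le_mul (h.2.2 σ) (h'.2.2 σ) (norm_nonneg _) (Nat.cast_nonneg _)

theorem one : SizeLE 1 (1 : L) :=
  ⟨one_pos, by simpa using isIntegral_one, by simp⟩

theorem pow (h : SizeLE E w) (n : ℕ) : SizeLE (E ^ n) (w ^ n) := by
  induction n with
  | zero => simpa using one
  | succ n ih => rw [pow_succ, pow_succ]; exact ih.mul h

theorem sum {ι : Type*} {s : Finset ι} {f : ι → L} (hs : s.Nonempty)
    (h : ∀ i ∈ s, SizeLE E (f i)) : SizeLE (s.card * E) (∑ i ∈ s, f i) := by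
  obtain ⟨i₀, hi₀⟩ := hs
  refine ⟨Nat.mul_pos (Finset.card_pos.2 ⟨i₀, hi₀⟩) (h i₀ hi₀).1, ?_, fun σ => ?_⟩
  · rw [Finset.mul_sum]
    refine IsIntegral.sum _ fun i hi => ?_
    have : ((s.card * E : ℕ) : L) * f i = (s.card : L) * ((E : L) * f i) := by push_cast; ring
    rw [this]
    exact (isIntegral_natCast_of_int _).mul (h i hi).2.1
  · rw [map_sum]
    refine (norm_sum_le _ _).trans ((Finset.sum_le_card_nsmul _ _ _ fun i hi => (h i hi).2.2 σ).trans ?_)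
    simp

theorem add (h : SizeLE E w) (h' : SizeLE E' w') : SizeLE (2 * (E * E')) (w + w') := by
  have := sum (s := Finset.univ) (f := ![w, w']) (E := E * E') Finset.univ_nonempty (by
    intro i _
    fin_cases i
    · exact h.mono_dvd (dvd_mul_right _ _) (Nat.mul_pos h.1 h'.1)
    · exact h'.mono_dvd (dvd_mul_left _ _) (Nat.mul_pos h.1 h'.1))
  simpa using this

theorem neg (h : SizeLE E w) : SizeLE E (-w) :=
  ⟨h.1, by simpa using h.2.1.neg, by simpa using h.2.2⟩

theorem natCast (n : ℕ) : SizeLE (n + 1) (n : L) := by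
  refine ⟨n.succ_pos, ?_, fun σ => by simp⟩
  have := isIntegral_algebraMap (R := ℤ) (A := L) (x := (((n + 1) * n : ℕ) : ℤ))
  simpa using this

theorem exists_of_isAlgebraic [CharZero L] [Algebra.IsAlgebraic ℚ L] (w : L) :
    ∃ E, SizeLE E w := by
  obtain ⟨y, hy, hyw⟩ := IsAlgebraic.exists_integral_multiple
    ((IsFractionRing.isAlgebraic_iff ℤ ℚ L).2 (Algebra.IsAlgebraic.isAlgebraic (R := ℚ) w))
  obtain ⟨B, hB⟩ : ∃ B : ℕ, ∀ σ : L →+* ℂ, ‖σ w‖ ≤ B := by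
    have hfin : ((minpoly ℚ w).rootSet ℂ).Finite := Polynomial.rootSet_finite _ _
    obtain ⟨b, hb⟩ := (hfin.image norm).bddAbove
    obtain ⟨B, hB⟩ := exists_nat_ge b
    refine ⟨B, fun σ => (hb ⟨σ w, ?_, rfl⟩).trans hB⟩
    rw [Polynomial.mem_rootSet]
    refine ⟨minpoly.ne_zero (Algebra.IsAlgebraic.isAlgebraic (R := ℚ) w).isIntegral, ?_⟩
    have := congrArg σ (minpoly.aeval ℚ w)
    rwa [map_zero, Polynomial.aeval_def, Polynomial.hom_eval₂,
      Subsingleton.elim (σ.comp (algebraMap ℚ L)) (algebraMap ℚ ℂ), ← Polynomial.aeval_def] at this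
  have hy' : 0 < y.natAbs := Int.natAbs_pos.2 hy
  refine ⟨y.natAbs * (B + 1), by positivity, ?_, fun σ => (hB σ).trans ?_⟩
  · have hab : IsIntegral ℤ ((y.natAbs : L) * w) := by
      rcases Int.natAbs_eq y with h | h
      · rw [h] at hyw
        simpa [zsmul_eq_mul] using hyw
      · rw [h] at hyw
        simpa [zsmul_eq_mul] using hyw
    have : ((y.natAbs * (B + 1) : ℕ) : L) * w = ((B + 1 : ℕ) : L) * ((y.natAbs : L) * w) := by
      push_cast; ring
    rw [this]
    exact (isIntegral_natCast_of_int _).mul hab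
  · have : B ≤ y.natAbs * (B + 1) := by nlinarith
    exact_mod_cast this

/-- Polynomial values have polynomially bounded size. -/
theorem eval {p : Polynomial L} {n : ℕ} (hn : p.natDegree ≤ n)
    (hp : ∀ i, SizeLE E (p.coeff i)) (hw : SizeLE E' w) :
    SizeLE ((n + 1) * (E * E' ^ n)) (p.eval w) := by
  rw [Polynomial.eval_eq_sum_range' (Nat.lt_succ_of_le hn)]
  have := sum (s := Finset.range (n + 1)) (f := fun i => p.coeff i * w ^ i) (E := E * E' ^ n)
    (by simp) (fun i hi => (hp i).mul
      ((hw.pow i).mono_dvd (pow_dvd_pow _ (by simp at hi; omega)) (pow_pos hw.1 _)))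
  simpa using this

/-- A root of a monic polynomial is bounded in terms of the coefficients. -/
theorem of_isRoot {p : Polynomial L} (hp : p.Monic) (hE : ∀ i, SizeLE E (p.coeff i))
    (hw : p.eval w = 0) : SizeLE (E * (p.natDegree + 1)) w := by
  have hE0 : 0 < E := (hE 0).1
  refine ⟨by positivity, ?_, fun σ => ?_⟩
  · have hroot : (p.scaleRoots (E : L)).eval ((E : L) * w) = 0 :=
      Polynomial.scaleRoots_eval₂_eq_zero (p := p) (r := w) (s := (E : L)) (RingHom.id L) hw
    have hEw : IsIntegral ℤ ((E : L) * w) := by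
      refine isIntegral_of_monic_root (p := p.scaleRoots (E : L))
        ((Polynomial.monic_scaleRoots_iff _).2 hp) (fun i => ?_)
        hroot
      rw [Polynomial.coeff_scaleRoots]
      rcases lt_trichotomy i p.natDegree with h | h | h
      · obtain ⟨j, hj⟩ := Nat.exists_eq_add_of_lt h
        rw [hj, show i + j + 1 - i = j + 1 by omega, pow_succ', ← mul_assoc, mul_comm (p.coeff i)]
        exact (hE i).2.1.mul ((isIntegral_natCast_of_int E).pow j)
      · rw [h, hp.coeff_natDegree]
        simpa using isIntegral_one
      · rw [Polynomial.coeff_eq_zero_of_natDegree_lt h]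
        simpa using isIntegral_zero
    have : ((E * (p.natDegree + 1) : ℕ) : L) * w = ((p.natDegree + 1 : ℕ) : L) * ((E : L) * w) := by
      push_cast; ring
    rw [this]
    exact (isIntegral_natCast_of_int _).mul hEw
  · have := ((NormedField.toAbsoluteValue ℂ).comp (f := σ) σ.injective).le_of_monic_root hp
      (E := E) (by exact_mod_cast hE0) (fun i => (hE i).2.2 σ) hw
    push_cast
    exact this

end SizeLE

theorem exists_coeff_sizeLE {L : Type*} [Field L] [CharZero L] [Algebra.IsAlgebraic ℚ L]
    (p : Polynomial L) : ∃ E, ∀ i, SizeLE E (p.coeff i) := by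
  choose E hE using SizeLE.exists_of_isAlgebraic (L := L)
  refine ⟨∏ i ∈ Finset.range (p.natDegree + 1), E (p.coeff i), fun i => ?_⟩
  have hpos : 0 < ∏ i ∈ Finset.range (p.natDegree + 1), E (p.coeff i) := by
    exact Finset.prod_pos fun i _ => (hE _).1
  by_cases hi : i < p.natDegree + 1
  · exact (hE _).mono_dvd (Finset.dvd_prod_of_mem (fun i => E (p.coeff i)) (Finset.mem_range.2 hi)) hpos
  · rw [Polynomial.coeff_eq_zero_of_natDegree_lt (by omega)]
    exact ⟨hpos, by simpa using isIntegral_zero, fun σ => by simpa using by positivity⟩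

/-- `ν` satisfies Liouville's inequality for the nonzero elements of `k`. -/
def IsLiouvilleAbs (k : Type*) {L : Type*} [Field k] [Field L] [Algebra k L]
    (ν : AbsoluteValue L ℝ) : Prop :=
  ∃ d : ℕ, ∀ w : k, w ≠ 0 → ∀ E : ℕ, SizeLE E (algebraMap k L w) →
    1 ≤ (E : ℝ) ^ d * ν (algebraMap k L w)

theorem exists_extension_of_embedding {k L M : Type*} [Field k] [Field L] [Algebra k L]
    [Algebra.IsAlgebraic k L] [Field M] [IsAlgClosed M] (φ : k →+* M) :
    ∃ σ : L →+* M, ∀ w, σ (algebraMap k L w) = φ w := by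
  algebraize [φ]
  exact ⟨(IsAlgClosed.lift (M := M) (R := k) (S := L)).toRingHom, fun w => AlgHom.commutes _ w⟩

/-- The norm of an algebraic number is controlled by any of its conjugates. -/
theorem norm_algebraNorm_le {k M : Type*} [Field k] [NumberField k] [NormedField M] [CharZero M]
    [IsAlgClosed M] {B : ℝ} (hB : 1 ≤ B) {β : k} (h : ∀ φ : k →+* M, ‖φ β‖ ≤ B) (φ₀ : k →+* M) :
    ‖((Algebra.norm ℚ β : ℚ) : M)‖ ≤ ‖φ₀ β‖ * B ^ Module.finrank ℚ k := by
  classical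
  have hn := Algebra.norm_eq_prod_embeddings ℚ M β
  rw [eq_ratCast] at hn
  rw [hn, norm_prod, ← Finset.mul_prod_erase _ _ (Finset.mem_univ φ₀.toRatAlgHom)]
  refine mul_le_mul_of_nonneg_left ?_ (norm_nonneg _)
  calc ∏ σ ∈ Finset.univ.erase φ₀.toRatAlgHom, ‖σ β‖
      ≤ ∏ σ ∈ Finset.univ.erase φ₀.toRatAlgHom, B :=
        Finset.prod_le_prod (fun _ _ => norm_nonneg _) fun σ _ => h σ
    _ = B ^ (Finset.univ.erase φ₀.toRatAlgHom).card := by rw [Finset.prod_const]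
    _ ≤ B ^ Module.finrank ℚ k := by
        refine pow_le_pow_right₀ hB ?_
        rw [← AlgHom.card ℚ k M]
        exact Finset.card_le_univ _

theorem exists_int_eq_algebraNorm {k : Type*} [Field k] [NumberField k] {β : k} (hβ : β ≠ 0)
    (hi : IsIntegral ℤ β) : ∃ N : ℤ, N ≠ 0 ∧ Algebra.norm ℚ β = N := by
  obtain ⟨N, hN⟩ := IsIntegrallyClosed.isIntegral_iff.1 (Algebra.isIntegral_norm (K := ℚ) hi)
  refine ⟨N, ?_, by simpa using hN.symm⟩
  rintro rfl
  rw [map_zero] at hN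
  exact hβ (Algebra.norm_eq_zero_iff.1 hN.symm)

theorem SizeLE.exists_norm {k L : Type*} [Field k] [NumberField k] [Field L] [CharZero L]
    [Algebra k L] [Algebra.IsAlgebraic k L] {E : ℕ} {w : k} (hw : w ≠ 0)
    (h : SizeLE E (algebraMap k L w)) :
    ∃ N : ℤ, N ≠ 0 ∧ Algebra.norm ℚ ((E : k) * w) = N ∧ IsIntegral ℤ ((E : k) * w) ∧
      ∀ φ : k →+* ℂ, ‖φ ((E : k) * w)‖ ≤ (E : ℝ) ^ 2 := by
  have hE : (E : k) ≠ 0 := by exact_mod_cast h.1.ne'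
  have hi : IsIntegral ℤ ((E : k) * w) := by
    rw [← isIntegral_algebraMap_iff (algebraMap k L).injective]
    simpa using h.2.1
  obtain ⟨N, hN, hN'⟩ := exists_int_eq_algebraNorm (mul_ne_zero hE hw) hi
  refine ⟨N, hN, hN', hi, fun φ => ?_⟩
  obtain ⟨σ, hσ⟩ := exists_extension_of_embedding (L := L) φ
  have := h.2.2 σ
  rw [hσ] at this
  rw [map_mul, norm_mul, pow_two]
  have hE' : ‖φ (E : k)‖ = E := by simp
  rw [hE']
  gcongr

theorem isLiouvilleAbs_complex (k : Type*) {L : Type*} [Field k] [NumberField k] [Field L]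
    [CharZero L] [Algebra k L] [Algebra.IsAlgebraic k L] (σ : L →+* ℂ) :
    IsLiouvilleAbs k ((NormedField.toAbsoluteValue ℂ).comp (f := σ) σ.injective) := by
  refine ⟨2 * Module.finrank ℚ k + 1, fun w hw E hE => ?_⟩
  obtain ⟨N, hN, hN', -, hb⟩ := hE.exists_norm hw
  have h1 : (1 : ℝ) ≤ E := by exact_mod_cast hE.1
  have := norm_algebraNorm_le (one_le_pow₀ h1) hb (σ.comp (algebraMap k L))
  rw [hN'] at this
  have h2 : (1 : ℝ) ≤ ‖((N : ℚ) : ℂ)‖ := by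
    have : (1 : ℝ) ≤ |(N : ℝ)| := by exact_mod_cast Int.one_le_abs hN
    simpa using this
  refine (h2.trans this).trans (le_of_eq ?_)
  have hE' : ‖σ (algebraMap k L (E : k))‖ = E := by simp
  simp only [RingHom.comp_apply, map_mul, norm_mul]
  rw [hE', ← pow_mul]
  change _ = _ * ‖σ (algebraMap k L w)‖
  ring

theorem PadicAlgCl.norm_le_one_of_isIntegral {p : ℕ} [Fact p.Prime] {x : PadicAlgCl p}
    (hx : IsIntegral ℤ x) : ‖x‖ ≤ 1 := by
  have hx' : IsIntegral (Valued.v (R := PadicAlgCl p)).integer x := hx.tower_top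
  exact Valuation.Integers.mem_of_integral (Valuation.integer.integers _) hx'

theorem Padic.one_le_abs_mul_norm {p : ℕ} [Fact p.Prime] {N : ℤ} (hN : N ≠ 0) :
    1 ≤ |(N : ℝ)| * ‖(N : ℚ_[p])‖ := by
  have hp : (0 : ℝ) < p := by exact_mod_cast (Fact.out : p.Prime).pos
  have hd : (p ^ (padicValInt p N) : ℤ) ∣ N := padicValInt_dvd N
  have hle : ((p : ℝ) ^ (padicValInt p N)) ≤ |(N : ℝ)| := by
    have := Int.le_of_dvd (abs_pos.2 hN) ((dvd_abs _ _).2 hd)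
    exact_mod_cast this
  rw [Padic.norm_eq_zpow_neg_valuation (by exact_mod_cast hN), Padic.valuation_intCast, zpow_neg,
    zpow_natCast, ← div_eq_mul_inv, one_le_div (by positivity)]
  exact hle

theorem isLiouvilleAbs_padic (k : Type*) {L : Type*} [Field k] [NumberField k] [Field L]
    [CharZero L] [Algebra k L] [Algebra.IsAlgebraic k L] {p : ℕ} [Fact p.Prime]
    (σ : L →+* PadicAlgCl p) :
    IsLiouvilleAbs k ((NormedField.toAbsoluteValue (PadicAlgCl p)).comp (f := σ) σ.injective) := by
  refine ⟨2 * Module.finrank ℚ k + 2, fun w hw E hE => ?_⟩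
  obtain ⟨N, hN, hN', hi, hb⟩ := hE.exists_norm hw
  have h1 : (1 : ℝ) ≤ E := by exact_mod_cast hE.1
  have h2 := norm_algebraNorm_le le_rfl
    (fun φ => PadicAlgCl.norm_le_one_of_isIntegral (hi.map (φ.toIntAlgHom)))
    (σ.comp (algebraMap k L))
  obtain ⟨φ₀⟩ : Nonempty (k →+* ℂ) := inferInstance
  have h3 := (norm_algebraNorm_le (one_le_pow₀ h1) hb φ₀).trans
    (mul_le_mul_of_nonneg_right (hb φ₀) (by positivity))
  have h4 := Padic.one_le_abs_mul_norm (p := p) hN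
  rw [hN'] at h2 h3
  have h5 : |(N : ℝ)| ≤ (E : ℝ) ^ 2 * ((E : ℝ) ^ 2) ^ Module.finrank ℚ k := by simpa using h3
  have h6 : ‖(N : ℚ_[p])‖ ≤ ‖σ (algebraMap k L w)‖ := by
    have e1 : ((N : ℚ) : PadicAlgCl p) = algebraMap ℚ_[p] (PadicAlgCl p) (N : ℚ_[p]) := by simp
    rw [e1, PadicAlgCl.norm_extends, one_pow, mul_one, map_mul, norm_mul] at h2
    refine h2.trans (mul_le_of_le_one_left (norm_nonneg _) ?_)
    have e2 := isIntegral_algebraMap (R := ℤ) (A := PadicAlgCl p) (x := (E : ℤ))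
    exact PadicAlgCl.norm_le_one_of_isIntegral (by simpa using e2)
  calc (1 : ℝ) ≤ |(N : ℝ)| * ‖(N : ℚ_[p])‖ := h4
    _ ≤ ((E : ℝ) ^ 2 * ((E : ℝ) ^ 2) ^ Module.finrank ℚ k) * ‖σ (algebraMap k L w)‖ := by gcongr
    _ = (E : ℝ) ^ (2 * Module.finrank ℚ k + 2) * ‖σ (algebraMap k L w)‖ := by ring

theorem Rat.isIntegral_of_padicNorm_le_one {x : ℚ}
    (h : ∀ (p : ℕ) [Fact p.Prime], ‖(x : ℚ_[p])‖ ≤ 1) : IsIntegral ℤ x := by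
  suffices hd : x.den = 1 by
    rw [← Rat.coe_int_num_of_den_eq_one hd]
    exact isIntegral_algebraMap (R := ℤ) (A := ℚ) (x := x.num)
  by_contra hd
  obtain ⟨p, hp, hpd⟩ := Nat.exists_prime_and_dvd hd
  have : Fact p.Prime := ⟨hp⟩
  have hnum : ¬ (p : ℤ) ∣ x.num := fun hpn =>
    Nat.not_coprime_of_dvd_of_dvd hp.one_lt (Int.natCast_dvd.1 hpn) hpd x.reduced
  have h1 : ¬ ‖((x.num : ℤ) : ℚ_[p])‖ < 1 := fun hlt => hnum (Padic.norm_intCast_lt_one_iff.1 hlt)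
  have h2 : ‖((x.den : ℤ) : ℚ_[p])‖ < 1 :=
    Padic.norm_intCast_lt_one_iff.2 (Int.natCast_dvd_natCast.2 hpd)
  have h3 : ((x.num : ℤ) : ℚ_[p]) = (x : ℚ_[p]) * ((x.den : ℤ) : ℚ_[p]) := by
    have := Rat.mul_den_eq_num x
    exact_mod_cast congrArg (fun y : ℚ => (y : ℚ_[p])) this.symm
  rw [h3, norm_mul] at h1
  exact h1 ((mul_le_of_le_one_left (norm_nonneg _) (h p)).trans_lt h2)

/-- The coefficients of a monic polynomial whose roots are `p`-adic integers are so too. -/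
theorem PadicAlgCl.norm_coeff_le_one {p : ℕ} [Fact p.Prime] {f : Polynomial (PadicAlgCl p)}
    (hf : f.Monic) (h : ∀ x, f.eval x = 0 → ‖x‖ ≤ 1) (i : ℕ) : ‖f.coeff i‖ ≤ 1 := by
  have hl : f ∈ Polynomial.lifts (algebraMap (Valued.v (R := PadicAlgCl p)).integer
      (PadicAlgCl p)) := by
    rw [(IsAlgClosed.splits f).eq_prod_roots_of_monic hf]
    refine multiset_prod_mem _ fun g hg => ?_
    obtain ⟨x, hx, rfl⟩ := Multiset.mem_map.1 hg
    have hx1 : ‖x‖ ≤ 1 := h x (Polynomial.isRoot_of_mem_roots hx)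
    exact (Polynomial.mem_lifts _).2 ⟨Polynomial.X - Polynomial.C ⟨x, hx1⟩, by simp; rfl⟩
  obtain ⟨c, hc⟩ := (Polynomial.lifts_iff_coeff_lifts _).1 hl i
  rw [← hc]
  exact c.2

/-- A number that is not an algebraic integer is large at some finite place. -/
theorem exists_padic_one_lt_norm {L : Type*} [Field L] [CharZero L] [Algebra.IsAlgebraic ℚ L]
    {t : L} (ht : ¬ IsIntegral ℤ t) :
    ∃ (p : ℕ) (_ : Fact p.Prime) (σ : L →+* PadicAlgCl p), 1 < ‖σ t‖ := by
  by_contra! hcon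
  have hti : IsIntegral ℚ t := (Algebra.IsAlgebraic.isAlgebraic (R := ℚ) t).isIntegral
  refine ht (isIntegral_of_monic_root (p := (minpoly ℚ t).map (algebraMap ℚ L))
    ((minpoly.monic hti).map _) (fun i => ?_) (by simp [Polynomial.eval_map_algebraMap]))
  rw [Polynomial.coeff_map]
  refine IsIntegral.algebraMap (Rat.isIntegral_of_padicNorm_le_one fun p _ => ?_)
  have key := PadicAlgCl.norm_coeff_le_one (p := p)
    (f := (minpoly ℚ t).map (algebraMap ℚ (PadicAlgCl p))) ((minpoly.monic hti).map _)
    (fun x hx => ?_) i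
  · rw [Polynomial.coeff_map, eq_ratCast] at key
    have e1 : (((minpoly ℚ t).coeff i : ℚ) : PadicAlgCl p) =
      algebraMap ℚ_[p] (PadicAlgCl p) (((minpoly ℚ t).coeff i : ℚ) : ℚ_[p]) := by simp
    rwa [e1, PadicAlgCl.norm_extends] at key
  · rw [Polynomial.eval_map_algebraMap] at hx
    obtain ⟨φ, rfl⟩ := IntermediateField.exists_algHom_of_splits_of_aeval (F := ℚ) (E := L)
      (K := PadicAlgCl p) (fun s => ⟨(Algebra.IsAlgebraic.isAlgebraic (R := ℚ) s).isIntegral,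
        IsAlgClosed.splits _⟩) hx
    exact hcon p inferInstance φ.toRingHom

/-- Kronecker's theorem: an element which is not a root of unity is large at some place. -/
theorem exists_isLiouvilleAbs_one_lt {k L : Type*} [Field k] [NumberField k] [Field L]
    [CharZero L] [Algebra k L] [Algebra.IsAlgebraic k L] {t : k} (ht : t ≠ 0)
    (hu : ∀ n : ℕ, 0 < n → t ^ n ≠ 1) :
    ∃ ν : AbsoluteValue L ℝ, IsLiouvilleAbs k ν ∧ 1 < ν (algebraMap k L t) := by
  by_cases hi : IsIntegral ℤ t
  · obtain ⟨φ, hφ⟩ : ∃ φ : k →+* ℂ, 1 < ‖φ t‖ := by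
      by_contra! hcon
      obtain ⟨n, hn, h1⟩ := NumberField.Embeddings.pow_eq_one_of_norm_le_one k ℂ ht hi hcon
      exact hu n hn h1
    obtain ⟨σ, hσ⟩ := exists_extension_of_embedding (L := L) φ
    refine ⟨_, isLiouvilleAbs_complex k σ, ?_⟩
    change 1 < ‖σ (algebraMap k L t)‖
    rwa [hσ]
  · have : Algebra.IsAlgebraic ℚ L := Algebra.IsAlgebraic.trans ℚ k L
    rw [← isIntegral_algebraMap_iff (algebraMap k L).injective] at hi
    obtain ⟨p, _, σ, hσ⟩ := exists_padic_one_lt_norm hi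
    exact ⟨_, isLiouvilleAbs_padic k σ, hσ⟩

/-- Among finitely many colours, one of them recurs infinitely often at `N` fixed positions. -/
theorem exists_infinite_shift_pattern {ι : Type*} [Finite ι] (col : ℕ → ι) (N : ℕ) :
    ∃ (c : ι) (i : Fin N → ℕ), Function.Injective i ∧ {m | ∀ s, col (m + i s) = c}.Infinite := by
  classical
  have := Fintype.ofFinite ι
  have : Nonempty ι := ⟨col 0⟩
  obtain ⟨y, hy⟩ := Finite.exists_infinite_fiber
    (fun (m : ℕ) (j : Fin (Fintype.card ι * N)) => col (m + j))
  obtain ⟨c, -, hc⟩ := Finset.exists_le_card_fiber_of_mul_le_card_of_maps_to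
    (s := (Finset.univ : Finset (Fin (Fintype.card ι * N)))) (t := Finset.univ) (f := y) (n := N)
    (fun _ _ => Finset.mem_univ _) Finset.univ_nonempty (by simp)
  obtain ⟨T, hT, hTc⟩ := Finset.exists_subset_card_eq hc
  refine ⟨c, fun s => ((T.orderEmbOfFin hTc s : Fin _) : ℕ), fun a b hab => ?_, ?_⟩
  · exact (T.orderEmbOfFin hTc).injective (Fin.ext hab)
  · refine (Set.infinite_coe_iff.1 hy).mono fun m hm s => ?_
    have h1 : y (T.orderEmbOfFin hTc s) = c :=
      (Finset.mem_filter.1 (hT (T.orderEmbOfFin_mem hTc s))).2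
    rw [← h1, ← (hm : _ = y)]

/-- Linear functional on `N` values of an exponential polynomial extracting one coefficient. -/
theorem exists_vandermonde_dual {k : Type*} [Field k] {N : ℕ} {v : Fin N → k}
    (hv : Function.Injective v) (n : Fin N) :
    ∃ c : Fin N → k, ∀ j : Fin N, ∑ s, c s * v s ^ (j : ℕ) = if j = n then 1 else 0 := by
  have hu : IsUnit (Matrix.vandermonde v) := by
    rw [Matrix.isUnit_iff_isUnit_det, isUnit_iff_ne_zero]
    exact Matrix.det_vandermonde_ne_zero_iff.2 hv
  obtain ⟨c, hc⟩ := Matrix.vecMul_surjective_iff_isUnit.2 hu (Pi.single n 1)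
  refine ⟨c, fun j => ?_⟩
  have := congrFun hc j
  simpa [Matrix.vecMul, dotProduct, Matrix.vandermonde_apply, Pi.single_apply] using this

/-- A sequence of elements of `k` of at most exponential size which is well approximated by the
values of finitely many power series along a geometric progression: one of the series is a
polynomial. -/
theorem exists_eq_polynomial_of_approx {k L ι : Type*} [Field k] [NumberField k] [Field L]
    [CharZero L] [Algebra k L] [Algebra.IsAlgebraic k L] [Finite ι] {ν : AbsoluteValue L ℝ}
    (hν : IsLiouvilleAbs k ν) {q : k} (hq0 : q ≠ 0) (hq : ν (algebraMap k L q) < 1) {κ : L}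
    (hκ : κ ≠ 0) {y : ℕ → k} {C D : ℕ}
    (hsize : ∀ m, SizeLE (C * D ^ m) (algebraMap k L (y m))) (ψ : ι → PowerSeries L)
    (happ : ∀ N : ℕ, ∃ B : ℝ, ∀ m, ∃ c, ν (algebraMap k L (y m) -
      (PowerSeries.trunc N (ψ c)).eval (κ * algebraMap k L q ^ m)) ≤
        B * ν (algebraMap k L q) ^ (N * m)) :
    ∃ c, ∃ g : Polynomial L, ψ c = g := by
  classical
  have := Fintype.ofFinite ι
  have : Algebra.IsAlgebraic ℚ L := Algebra.IsAlgebraic.trans ℚ k L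
  obtain ⟨d, hd⟩ := hν
  set ρ := ν (algebraMap k L q) with hρ
  have hq0' : algebraMap k L q ≠ 0 := by simpa using hq0
  have hρ0 : 0 < ρ := ν.pos hq0'
  have hD : 0 < D := Nat.pos_of_ne_zero fun h => by simpa [h] using (hsize 1).1
  obtain ⟨N₀, hN₀⟩ : ∃ N₀ : ℕ, (D : ℝ) ^ d * ρ ^ N₀ < 1 := by
    obtain ⟨N₀, h⟩ := exists_pow_lt_of_lt_one (y := ρ) (x := ((D : ℝ) ^ d)⁻¹) (by positivity) hq
    exact ⟨N₀, by rwa [← one_div, lt_div_iff₀' (by positivity)] at h⟩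
  by_contra! hcon
  have hcoef : ∀ c, ∃ n, N₀ ≤ n ∧ PowerSeries.coeff n (ψ c) ≠ 0 := by
    intro c
    by_contra! hc
    refine hcon c (PowerSeries.trunc N₀ (ψ c)) ?_
    ext n
    rw [Polynomial.coeff_coe, PowerSeries.coeff_trunc]
    split_ifs with h
    · rfl
    · exact hc n (by omega)
  choose n hn hnc using hcoef
  obtain ⟨N, hN⟩ : ∃ N, ∀ c, n c < N :=
    ⟨∑ c, n c + 1, fun c => Nat.lt_succ_of_le (Finset.single_le_sum (f := n) (by simp) (by simp))⟩
  obtain ⟨B, hB⟩ := happ N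
  choose col hcol using hB
  obtain ⟨c, i, hi, hinf⟩ := exists_infinite_shift_pattern col N
  have hqinj : Function.Injective fun s => q ^ i s := by
    intro a b hab
    refine hi (pow_right_injective₀ hρ0 hq.ne ?_)
    have := congrArg (fun x => ν (algebraMap k L x)) hab
    simpa using this
  obtain ⟨e, he⟩ := exists_vandermonde_dual hqinj ⟨n c, hN c⟩
  set w : ℕ → k := fun m => ∑ s, e s * y (m + i s) with hw
  set lead : L := PowerSeries.coeff (n c) (ψ c) * κ ^ n c with hlead
  have hlead0 : 0 < ν lead := ν.pos (mul_ne_zero (hnc c) (pow_ne_zero _ hκ))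
  have hmain : ∀ m, ∑ s, algebraMap k L (e s) *
      (PowerSeries.trunc N (ψ c)).eval (κ * algebraMap k L q ^ (m + i s)) =
        lead * algebraMap k L q ^ (n c * m) := by
    intro m
    have hterm : ∀ s, (PowerSeries.trunc N (ψ c)).eval (κ * algebraMap k L q ^ (m + i s)) =
        ∑ j : Fin N, PowerSeries.coeff j (ψ c) * κ ^ (j : ℕ) * algebraMap k L q ^ (j * m) *
          algebraMap k L ((q ^ i s) ^ (j : ℕ)) := by
      intro s
      rw [Polynomial.eval, PowerSeries.eval₂_trunc_eq_sum_range]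
      simp only [RingHom.id_apply]
      rw [← Fin.sum_univ_eq_sum_range
        (fun j => PowerSeries.coeff j (ψ c) * (κ * algebraMap k L q ^ (m + i s)) ^ j)]
      refine Finset.sum_congr rfl fun j _ => ?_
      rw [map_pow, map_pow]
      ring
    simp only [hterm, Finset.mul_sum]
    rw [Finset.sum_comm]
    have hj : ∀ j : Fin N, ∑ s, algebraMap k L (e s) * (PowerSeries.coeff j (ψ c) * κ ^ (j : ℕ) *
        algebraMap k L q ^ (j * m) * algebraMap k L ((q ^ i s) ^ (j : ℕ))) =
        PowerSeries.coeff j (ψ c) * κ ^ (j : ℕ) * algebraMap k L q ^ (j * m) *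
          algebraMap k L (if j = ⟨n c, hN c⟩ then 1 else 0) := by
      intro j
      rw [← he j, map_sum, Finset.mul_sum]
      refine Finset.sum_congr rfl fun s _ => ?_
      rw [map_mul]
      ring
    simp only [hj]
    rw [Finset.sum_eq_single ⟨n c, hN c⟩ (fun j _ hj => by simp [hj]) (by simp)]
    simp [hlead]
  set B' : ℝ := ∑ s, ν (algebraMap k L (e s)) * |B| with hB'
  have herr : ∀ m, (∀ s, col (m + i s) = c) →
      ν (algebraMap k L (w m) - lead * algebraMap k L q ^ (n c * m)) ≤ B' * ρ ^ (N * m) := by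
    intro m hm
    rw [← hmain m, hw, map_sum, ← Finset.sum_sub_distrib, hB', Finset.sum_mul]
    refine (ν.sum_le _ _).trans (Finset.sum_le_sum fun s _ => ?_)
    rw [map_mul, ← mul_sub, map_mul, mul_assoc]
    refine mul_le_mul_of_nonneg_left ?_ (ν.nonneg _)
    have := hcol (m + i s)
    rw [hm s] at this
    refine this.trans ?_
    calc B * ρ ^ (N * (m + i s)) ≤ |B| * ρ ^ (N * (m + i s)) := by
          gcongr
          exact le_abs_self B
      _ ≤ |B| * ρ ^ (N * m) := by
          refine mul_le_mul_of_nonneg_left ?_ (abs_nonneg _)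
          exact pow_le_pow_of_le_one hρ0.le hq.le (Nat.mul_le_mul_left _ (by omega))
  obtain ⟨E, hE⟩ : ∃ E : ℕ, ∀ m, SizeLE (E * D ^ m) (algebraMap k L (w m)) := by
    choose S hS using SizeLE.exists_of_isAlgebraic (L := L)
    have hpos : 0 < ∏ s, S (algebraMap k L (e s)) := Finset.prod_pos fun s _ => (hS _).1
    have hC : 0 < C := Nat.pos_of_mul_pos_right (hsize 0).1
    have hNpos : 0 < N := by have := hN c; omega
    refine ⟨N * ((∏ s, S (algebraMap k L (e s))) * (C * D ^ (∑ s, i s))), fun m => ?_⟩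
    have hsum := SizeLE.sum (s := (Finset.univ : Finset (Fin N)))
      (E := (∏ s, S (algebraMap k L (e s))) * (C * D ^ (m + ∑ s, i s)))
      (f := fun s => algebraMap k L (e s) * algebraMap k L (y (m + i s)))
      ⟨⟨0, hNpos⟩, Finset.mem_univ _⟩ (fun s _ => ?_)
    · rw [hw, map_sum]
      simp only [map_mul]
      convert hsum using 1
      rw [Finset.card_univ, Fintype.card_fin]
      ring
    · refine ((hS (algebraMap k L (e s))).mono_dvd
        (Finset.dvd_prod_of_mem (fun s => S (algebraMap k L (e s))) (Finset.mem_univ s)) hpos).mul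
        ((hsize (m + i s)).mono_dvd (Nat.mul_dvd_mul_left _ (pow_dvd_pow _ ?_)) (by positivity))
      exact Nat.add_le_add_left (Finset.single_le_sum (f := i) (by simp) (Finset.mem_univ s)) _
  have hev : ∀ᶠ m in Filter.atTop, B' * ρ ^ m < ν lead ∧
      (E : ℝ) ^ d * (ν lead + B') * ((D : ℝ) ^ d * ρ ^ N₀) ^ m < 1 := by
    have t1 : Filter.Tendsto (fun m : ℕ => B' * ρ ^ m) Filter.atTop (nhds (B' * 0)) :=
      (tendsto_pow_atTop_nhds_zero_of_lt_one hρ0.le hq).const_mul _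
    have t2 : Filter.Tendsto (fun m : ℕ => (E : ℝ) ^ d * (ν lead + B') *
        ((D : ℝ) ^ d * ρ ^ N₀) ^ m) Filter.atTop (nhds ((E : ℝ) ^ d * (ν lead + B') * 0)) :=
      (tendsto_pow_atTop_nhds_zero_of_lt_one (by positivity) hN₀).const_mul _
    rw [mul_zero] at t1 t2
    exact (t1.eventually_lt_const hlead0).and (t2.eventually_lt_const one_pos)
  obtain ⟨M, hM⟩ := Filter.eventually_atTop.1 hev
  obtain ⟨m, hm, hmM⟩ := hinf.exists_gt M
  obtain ⟨h1, h2⟩ := hM m hmM.le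
  have hB'0 : 0 ≤ B' := Finset.sum_nonneg fun s _ => by positivity
  have hlt : B' * ρ ^ (N * m) < ν (lead * algebraMap k L q ^ (n c * m)) := by
    rw [map_mul, map_pow]
    calc B' * ρ ^ (N * m) ≤ B' * ρ ^ (m + n c * m) := by
          refine mul_le_mul_of_nonneg_left ?_ hB'0
          refine pow_le_pow_of_le_one hρ0.le hq.le ?_
          calc m + n c * m = (n c + 1) * m := by ring
            _ ≤ N * m := Nat.mul_le_mul_right _ (hN c)
      _ = B' * ρ ^ m * ρ ^ (n c * m) := by rw [pow_add]; ring
      _ < ν lead * ρ ^ (n c * m) := by gcongr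
  have hw0 : w m ≠ 0 := by
    intro h0
    have := herr m hm
    rw [h0, map_zero, zero_sub, map_neg_eq_map] at this
    exact absurd hlt (not_lt.2 this)
  have hup : ν (algebraMap k L (w m)) ≤ (ν lead + B') * ρ ^ (N₀ * m) := by
    have h3 : ρ ^ (N * m) ≤ ρ ^ (N₀ * m) :=
      pow_le_pow_of_le_one hρ0.le hq.le (Nat.mul_le_mul_right _ ((hn c).trans (hN c).le))
    have h4 : ρ ^ (n c * m) ≤ ρ ^ (N₀ * m) :=
      pow_le_pow_of_le_one hρ0.le hq.le (Nat.mul_le_mul_right _ (hn c))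
    calc ν (algebraMap k L (w m))
        = ν ((algebraMap k L (w m) - lead * algebraMap k L q ^ (n c * m)) +
            lead * algebraMap k L q ^ (n c * m)) := by rw [sub_add_cancel]
      _ ≤ B' * ρ ^ (N * m) + ν lead * ρ ^ (n c * m) := by
          refine (ν.add_le _ _).trans (add_le_add (herr m hm) (le_of_eq ?_))
          rw [map_mul, map_pow]
      _ ≤ B' * ρ ^ (N₀ * m) + ν lead * ρ ^ (N₀ * m) := by gcongr
      _ = _ := by ring
  have := hd (w m) hw0 _ (hE m)
  refine absurd h2 (not_lt.2 (this.trans ?_))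
  calc ((E * D ^ m : ℕ) : ℝ) ^ d * ν (algebraMap k L (w m))
      ≤ ((E * D ^ m : ℕ) : ℝ) ^ d * ((ν lead + B') * ρ ^ (N₀ * m)) := by gcongr
    _ = _ := by push_cast; rw [mul_pow, mul_pow, ← pow_mul, ← pow_mul, ← pow_mul]; ring

section Radicals

variable {F : Type*} [Field F] [CharZero F]

theorem exists_root_quadratic (h2 : ∀ x : F, ∃ y, y ^ 2 = x) (b c : F) :
    ∃ z, z ^ 2 + b * z + c = 0 := by
  obtain ⟨y, hy⟩ := h2 (b ^ 2 / 4 - c)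
  exact ⟨y - b / 2, by linear_combination hy⟩

theorem exists_root_cubic (h2 : ∀ x : F, ∃ y, y ^ 2 = x) (h3 : ∀ x : F, ∃ y, y ^ 3 = x)
    (b c d : F) : ∃ z, z ^ 3 + b * z ^ 2 + c * z + d = 0 := by
  suffices H : ∀ p q : F, ∃ z, z ^ 3 + p * z + q = 0 by
    obtain ⟨z, hz⟩ := H (c - b ^ 2 / 3) (2 * b ^ 3 / 27 - b * c / 3 + d)
    exact ⟨z - b / 3, by linear_combination hz⟩
  intro p q
  by_cases hp : p = 0
  · obtain ⟨z, hz⟩ := h3 (-q)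
    exact ⟨z, by rw [hp]; linear_combination hz⟩
  obtain ⟨w, hw⟩ := h2 (q ^ 2 / 4 + p ^ 3 / 27)
  obtain ⟨u, hu⟩ := h3 (-q / 2 + w)
  have hu0 : u ≠ 0 := by
    rintro rfl
    refine hp (pow_eq_zero_iff (n := 3) (by norm_num) |>.1 ?_)
    linear_combination 27 * (-q / 2 - w) * hu - 27 * hw
  refine ⟨u - p / (3 * u), ?_⟩
  field_simp
  linear_combination (27 * u ^ 3 + 27 * q / 2 + 27 * w) * hu + 27 * hw

theorem exists_root_quartic (h2 : ∀ x : F, ∃ y, y ^ 2 = x) (h3 : ∀ x : F, ∃ y, y ^ 3 = x)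
    (b c d e : F) : ∃ z, z ^ 4 + b * z ^ 3 + c * z ^ 2 + d * z + e = 0 := by
  suffices H : ∀ p q r : F, ∃ z, z ^ 4 + p * z ^ 2 + q * z + r = 0 by
    obtain ⟨z, hz⟩ := H (c - 3 * b ^ 2 / 8) (b ^ 3 / 8 - b * c / 2 + d)
      (-3 * b ^ 4 / 256 + b ^ 2 * c / 16 - b * d / 4 + e)
    exact ⟨z - b / 4, by linear_combination hz⟩
  intro p q r
  by_cases hq : q = 0
  · obtain ⟨w, hw⟩ := exists_root_quadratic h2 p r
    obtain ⟨z, rfl⟩ := h2 w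
    exact ⟨z, by rw [hq]; linear_combination hw⟩
  obtain ⟨A, hA⟩ := exists_root_cubic h2 h3 (2 * p) (p ^ 2 - 4 * r) (-q ^ 2)
  obtain ⟨α, rfl⟩ := h2 A
  have hα : α ≠ 0 := by
    rintro rfl
    exact hq (pow_eq_zero_iff (n := 2) (by norm_num) |>.1 (by linear_combination -hA))
  obtain ⟨z, hz⟩ := exists_root_quadratic h2 α ((p + α ^ 2 - q / α) / 2)
  refine ⟨z, ?_⟩
  have hprod : z ^ 4 + p * z ^ 2 + q * z + r = (z ^ 2 + α * z + (p + α ^ 2 - q / α) / 2) *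
      (z ^ 2 - α * z + (p + α ^ 2 + q / α) / 2) := by
    field_simp
    linear_combination -hA
  rw [hprod, hz, zero_mul]

theorem exists_root_of_natDegree_le_four (h2 : ∀ x : F, ∃ y, y ^ 2 = x)
    (h3 : ∀ x : F, ∃ y, y ^ 3 = x) {g : Polynomial F} (hg0 : 0 < g.natDegree)
    (hgd : g.natDegree ≤ 4) : ∃ z, g.eval z = 0 := by
  have hgne : g ≠ 0 := Polynomial.ne_zero_of_natDegree_gt hg0
  have hl : g.leadingCoeff ≠ 0 := Polynomial.leadingCoeff_ne_zero.2 hgne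
  obtain ⟨m, hm⟩ : ∃ m, m = g * Polynomial.C g.leadingCoeff⁻¹ := ⟨_, rfl⟩
  have hmm : m.Monic := by rw [hm]; exact Polynomial.monic_mul_leadingCoeff_inv hgne
  have hmd : m.natDegree = g.natDegree := by
    rw [hm]; exact Polynomial.natDegree_mul_leadingCoeff_self_inv g
  suffices h : ∃ z, m.eval z = 0 by
    obtain ⟨z, hz⟩ := h
    refine ⟨z, ?_⟩
    rw [hm, Polynomial.eval_mul, Polynomial.eval_C] at hz
    exact (mul_eq_zero.1 hz).resolve_right (inv_ne_zero hl)
  rw [← hmd] at hgd hg0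
  have hlast := hmm.coeff_natDegree
  simp only [Polynomial.eval_eq_sum_range]
  generalize m.natDegree = n at *
  interval_cases n <;> simp only [Finset.sum_range_succ, Finset.sum_range_zero, hlast]
  · exact ⟨-m.coeff 0, by ring⟩
  · obtain ⟨z, hz⟩ := exists_root_quadratic h2 (m.coeff 1) (m.coeff 0)
    exact ⟨z, by linear_combination hz⟩
  · obtain ⟨z, hz⟩ := exists_root_cubic h2 h3 (m.coeff 2) (m.coeff 1) (m.coeff 0)
    exact ⟨z, by linear_combination hz⟩
  · obtain ⟨z, hz⟩ := exists_root_quartic h2 h3 (m.coeff 3) (m.coeff 2) (m.coeff 1) (m.coeff 0)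
    exact ⟨z, by linear_combination hz⟩

/-- Over a field with square and cube roots, polynomials of degree at most four split. -/
theorem splits_of_natDegree_le_four (h2 : ∀ x : F, ∃ y, y ^ 2 = x)
    (h3 : ∀ x : F, ∃ y, y ^ 3 = x) {p : Polynomial F} (hp : p.natDegree ≤ 4) : p.Splits := by
  obtain ⟨n, hn⟩ : ∃ n, p.natDegree = n := ⟨_, rfl⟩
  induction n generalizing p with
  | zero => exact Polynomial.Splits.of_natDegree_eq_zero hn
  | succ n ih =>
    have hp0 : p ≠ 0 := Polynomial.ne_zero_of_natDegree_gt (n := 0) (by omega)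
    obtain ⟨z, hz⟩ := exists_root_of_natDegree_le_four h2 h3 (by omega) hp
    obtain ⟨q, rfl⟩ := Polynomial.dvd_iff_isRoot.2 hz
    have hq0 : q ≠ 0 := right_ne_zero_of_mul hp0
    rw [Polynomial.natDegree_mul (Polynomial.X_sub_C_ne_zero z) hq0,
      Polynomial.natDegree_X_sub_C] at hn hp
    exact (Polynomial.Splits.X_sub_C z).mul (ih (by omega) (by omega))

end Radicals

section Puiseux

variable {L : Type*} [Field L]

theorem PowerSeries.exists_pow_eq [CharZero L] [IsAlgClosed L] {n : ℕ} (hn : 0 < n)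
    {u : PowerSeries L} (hu : PowerSeries.constantCoeff u ≠ 0) : ∃ v, v ^ n = u := by
  obtain ⟨c, hc⟩ := IsAlgClosed.exists_pow_nat_eq (PowerSeries.constantCoeff u) hn
  have hc0 : c ≠ 0 := by
    rintro rfl
    exact hu (by rw [← hc, zero_pow hn.ne'])
  have hH : HenselianRing (PowerSeries L) (.span {PowerSeries.X}) := inferInstance
  obtain ⟨v, hv, -⟩ := hH.is_henselian (Polynomial.X ^ n - Polynomial.C u)
    (Polynomial.monic_X_pow_sub_C u hn.ne') (PowerSeries.C c) (by
      rw [Ideal.mem_span_singleton, PowerSeries.X_dvd_iff]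
      simp [hc]) (by
      apply IsUnit.map
      rw [PowerSeries.isUnit_iff_constantCoeff]
      simp [Polynomial.derivative_X_pow, hn.ne', hc0])
  exact ⟨v, by simpa [sub_eq_zero] using hv⟩

/-- The embedding of Laurent series in `X ^ (1 / e)` into Hahn series with rational exponents. -/
def ramify (L : Type*) [Field L] (e : ℕ+) : LaurentSeries L →+* HahnSeries ℚ L :=
  HahnSeries.embDomainRingHom
    ((AddMonoidHom.mulRight ((e : ℚ)⁻¹)).comp (Int.castAddHom ℚ))
    (fun a b h => by simpa using h)
    (fun a b => by
      have : (0 : ℚ) < (e : ℚ)⁻¹ := by positivity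
      simp [this])

/-- The substitution `X ↦ X ^ e` on Laurent series. -/
def LaurentSeries.expand (L : Type*) [Field L] (e : ℕ+) : LaurentSeries L →+* LaurentSeries L :=
  HahnSeries.embDomainRingHom (AddMonoidHom.mulRight (e : ℤ))
    (fun a b h => by simpa using h)
    (fun a b => by simp)

theorem HahnSeries.embDomain_embDomain {Γ Γ' Γ'' : Type*} [PartialOrder Γ] [PartialOrder Γ']
    [PartialOrder Γ''] {R : Type*} [Zero R] {f : Γ ↪o Γ'} {g : Γ' ↪o Γ''} {h : Γ ↪o Γ''}
    (hfg : ∀ a, g (f a) = h a) (x : HahnSeries Γ R) :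
    (x.embDomain f).embDomain g = x.embDomain h := by
  ext b
  by_cases hb : b ∈ Set.range h
  · obtain ⟨a, rfl⟩ := hb
    rw [← hfg, HahnSeries.embDomain_coeff, HahnSeries.embDomain_coeff, hfg,
      HahnSeries.embDomain_coeff]
  · rw [HahnSeries.embDomain_of_notMem_range hb]
    by_cases hb' : b ∈ Set.range g
    · obtain ⟨a, rfl⟩ := hb'
      rw [HahnSeries.embDomain_coeff, HahnSeries.embDomain_of_notMem_range]
      rintro ⟨c, rfl⟩
      exact hb ⟨c, (hfg c).symm⟩
    · rw [HahnSeries.embDomain_of_notMem_range hb']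

theorem ramify_expand (e f : ℕ+) (x : LaurentSeries L) :
    ramify L (e * f) (LaurentSeries.expand L f x) = ramify L e x := by
  refine HahnSeries.embDomain_embDomain (fun a => ?_) x
  simp
  field_simp

theorem ramify_single (e : ℕ+) (n : ℤ) (a : L) :
    ramify L e (HahnSeries.single n a) = HahnSeries.single (n * (e : ℚ)⁻¹) a :=
  HahnSeries.embDomain_single

theorem LaurentSeries.expand_single (e : ℕ+) (n : ℤ) (a : L) :
    LaurentSeries.expand L e (HahnSeries.single n a) = HahnSeries.single (n * (e : ℤ)) a :=
  HahnSeries.embDomain_single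

/-- The field of Puiseux series. -/
def puiseuxField (L : Type*) [Field L] : Subfield (HahnSeries ℚ L) :=
  ⨆ e : ℕ+, (ramify L e).fieldRange

theorem mem_puiseuxField {x : HahnSeries ℚ L} :
    x ∈ puiseuxField L ↔ ∃ (e : ℕ+) (y : LaurentSeries L), ramify L e y = x := by
  rw [puiseuxField, Subfield.mem_iSup_of_directed]
  · simp only [RingHom.mem_fieldRange]
  · intro e f
    refine ⟨e * f, ?_, ?_⟩
    · rintro _ ⟨y, rfl⟩
      exact ⟨_, ramify_expand e f y⟩
    · rintro _ ⟨y, rfl⟩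
      rw [mul_comm]
      exact ⟨_, ramify_expand f e y⟩

theorem exists_pow_eq_expand [CharZero L] [IsAlgClosed L] (n : ℕ+) (x : LaurentSeries L) :
    ∃ y, y ^ (n : ℕ) = LaurentSeries.expand L n x := by
  by_cases hx : x = 0
  · exact ⟨0, by rw [hx, map_zero, zero_pow n.pos.ne']⟩
  obtain ⟨v, hv⟩ := PowerSeries.exists_pow_eq n.pos (u := x.powerSeriesPart) (by
    rw [← PowerSeries.coeff_zero_eq_constantCoeff_apply, LaurentSeries.powerSeriesPart_coeff]
    simpa using HahnSeries.coeff_order_eq_zero.not.2 hx)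
  refine ⟨HahnSeries.single x.order 1 * LaurentSeries.expand L n (HahnSeries.ofPowerSeries ℤ L v),
    ?_⟩
  conv_rhs => rw [← LaurentSeries.single_order_mul_powerSeriesPart x, map_mul, ← hv, map_pow,
    map_pow]
  rw [mul_pow, HahnSeries.single_pow, LaurentSeries.expand_single]
  simp [mul_comm]

theorem puiseuxField_exists_pow_eq [CharZero L] [IsAlgClosed L] (n : ℕ+) (x : puiseuxField L) :
    ∃ y, y ^ (n : ℕ) = x := by
  obtain ⟨e, y, hy⟩ := mem_puiseuxField.1 x.2
  obtain ⟨z, hz⟩ := exists_pow_eq_expand n y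
  refine ⟨⟨ramify L (e * n) z, mem_puiseuxField.2 ⟨_, _, rfl⟩⟩, Subtype.ext ?_⟩
  rw [SubmonoidClass.coe_pow, ← hy, ← ramify_expand e n, ← map_pow, hz]

theorem puiseuxField_splits [CharZero L] [IsAlgClosed L] {p : Polynomial (puiseuxField L)}
    (hp : p.natDegree ≤ 4) : p.Splits := by
  have : CharZero (HahnSeries ℚ L) := charZero_of_injective_ringHom
    (f := HahnSeries.C (Γ := ℚ) (R := L)) HahnSeries.C_injective
  have : CharZero (puiseuxField L) := inferInstance
  exact splits_of_natDegree_le_four (puiseuxField_exists_pow_eq 2) (puiseuxField_exists_pow_eq 3) hp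

/-- The inclusion of polynomials in `X` into power series in `X ^ (1 / e)`. -/
def expandPowerSeries (L : Type*) [Field L] (e : ℕ) : Polynomial L →+* PowerSeries L :=
  Polynomial.coeToPowerSeries.ringHom.comp (Polynomial.expand L e).toRingHom

theorem ramify_expandPowerSeries (e : ℕ+) (g : Polynomial L) :
    ramify L e (HahnSeries.ofPowerSeries ℤ L (expandPowerSeries L e g)) =
      ramify L 1 (HahnSeries.ofPowerSeries ℤ L g) := by
  have he : (e : ℚ) ≠ 0 := by positivity
  suffices h : ((ramify L e).comp (HahnSeries.ofPowerSeries ℤ L)).comp (expandPowerSeries L e) =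
      ((ramify L 1).comp (HahnSeries.ofPowerSeries ℤ L)).comp
        Polynomial.coeToPowerSeries.ringHom from congrArg (fun φ => φ g) h
  refine Polynomial.ringHom_ext (fun a => ?_) ?_
  · simp [expandPowerSeries, ramify_single]
  · simp [expandPowerSeries, ramify_single, HahnSeries.single_pow, he]

theorem exists_ramify_roots (Φ : Multiset (puiseuxField L)) :
    ∃ (e : ℕ+) (Y : Multiset (LaurentSeries L)),
      Y.map (ramify L e) = Φ.map (puiseuxField L).subtype := by
  induction Φ using Multiset.induction with
  | empty => exact ⟨1, 0, rfl⟩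
  | cons a Φ ih =>
    obtain ⟨e, Y, hY⟩ := ih
    obtain ⟨f, y, hy⟩ := mem_puiseuxField.1 a.2
    refine ⟨e * f, LaurentSeries.expand L e y ::ₘ Y.map (LaurentSeries.expand L f), ?_⟩
    rw [Multiset.map_cons, Multiset.map_cons, ← hY, Subfield.subtype_apply, ← hy,
      Multiset.map_map]
    congr 1
    · rw [mul_comm, ramify_expand]
    · exact Multiset.map_congr rfl fun x _ => ramify_expand e f x

/-- Newton-Puiseux theorem in degree at most four. -/
theorem exists_puiseux_factorization [CharZero L] [IsAlgClosed L]
    {f : Polynomial (Polynomial L)} (hf : f.Monic) (hd : f.natDegree ≤ 4) :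
    ∃ e : ℕ, 0 < e ∧ ∃ Φ : Multiset (PowerSeries L),
      f.map (expandPowerSeries L e) =
        (Φ.map fun φ => Polynomial.X - Polynomial.C φ).prod := by
  set j : Polynomial L →+* puiseuxField L :=
    (((ramify L 1).comp (HahnSeries.ofPowerSeries ℤ L)).comp
      Polynomial.coeToPowerSeries.ringHom).codRestrict (puiseuxField L)
      (fun g => mem_puiseuxField.2 ⟨1, _, rfl⟩) with hj
  have hs : (f.map j).Splits := puiseuxField_splits (Polynomial.natDegree_map_le.trans hd)
  have hs1 := hs.eq_prod_roots_of_monic (hf.map j)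
  obtain ⟨e, Y, hY⟩ := exists_ramify_roots (f.map j).roots
  have hfY : f.map ((HahnSeries.ofPowerSeries ℤ L).comp (expandPowerSeries L e)) =
      (Y.map fun y => Polynomial.X - Polynomial.C y).prod := by
    apply Polynomial.map_injective (ramify L e) (ramify L e).injective
    rw [Polynomial.map_map, Polynomial.map_multiset_prod, Multiset.map_map]
    have h1 : (ramify L e).comp ((HahnSeries.ofPowerSeries ℤ L).comp (expandPowerSeries L e)) =
        (puiseuxField L).subtype.comp j :=
      RingHom.ext fun g => ramify_expandPowerSeries e g
    rw [h1, ← Polynomial.map_map, hs1, Polynomial.map_multiset_prod, Multiset.map_map]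
    have h2 : (f.map j).roots.map (Polynomial.map (puiseuxField L).subtype ∘
        fun x => Polynomial.X - Polynomial.C x) = ((f.map j).roots.map
          (puiseuxField L).subtype).map (fun x => Polynomial.X - Polynomial.C x) := by
      rw [Multiset.map_map]
      exact Multiset.map_congr rfl fun x _ => by simp
    rw [h2, ← hY, Multiset.map_map]
    congr 1
    exact Multiset.map_congr rfl fun x _ => by simp
  have h_int : ∀ y ∈ Y, ∃ φ : PowerSeries L, HahnSeries.ofPowerSeries ℤ L φ = y := by
    intro y hy
    refine IsIntegrallyClosed.isIntegral_iff (R := PowerSeries L) (K := LaurentSeries L).1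
      ⟨f.map (expandPowerSeries L e), hf.map _, ?_⟩
    change Polynomial.eval₂ (HahnSeries.ofPowerSeries ℤ L) y _ = 0
    rw [← Polynomial.eval_map, Polynomial.map_map, hfY, Polynomial.eval_multiset_prod,
      Multiset.map_map]
    exact Multiset.prod_eq_zero (Multiset.mem_map.2 ⟨y, hy, by simp⟩)
  choose! Ψ hΨ using h_int
  refine ⟨e, e.pos, Y.map Ψ, ?_⟩
  apply Polynomial.map_injective (HahnSeries.ofPowerSeries ℤ L) HahnSeries.ofPowerSeries_injective
  rw [Polynomial.map_map, hfY, Polynomial.map_multiset_prod, Multiset.map_map, Multiset.map_map]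
  congr 1
  exact Multiset.map_congr rfl fun y hy => by simp [hΨ y hy]

end Puiseux

section Approximation

variable {L : Type*} [Field L]

theorem AbsoluteValue.exists_bound_eval (ν : AbsoluteValue L ℝ) (p : Polynomial L) (R : ℝ) :
    ∃ B, 0 ≤ B ∧ ∀ s, ν s ≤ R → ν (p.eval s) ≤ B := by
  induction p using Polynomial.induction_on' with
  | add p q hp hq =>
    obtain ⟨B, hB0, hB⟩ := hp
    obtain ⟨B', hB0', hB'⟩ := hq
    refine ⟨B + B', by positivity, fun s hs => ?_⟩
    rw [Polynomial.eval_add]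
    exact (ν.add_le _ _).trans (add_le_add (hB s hs) (hB' s hs))
  | monomial n a =>
    refine ⟨ν a * |R| ^ n, by positivity, fun s hs => ?_⟩
    rw [Polynomial.eval_monomial, map_mul, map_pow]
    gcongr
    exact hs.trans (le_abs_self R)

theorem AbsoluteValue.exists_bound_evalEval (ν : AbsoluteValue L ℝ)
    (p : Polynomial (Polynomial L)) (R : ℝ) :
    ∃ B, 0 ≤ B ∧ ∀ s z, ν s ≤ R → ν z ≤ R → ν (p.evalEval s z) ≤ B := by
  induction p using Polynomial.induction_on' with
  | add p q hp hq =>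
    obtain ⟨B, hB0, hB⟩ := hp
    obtain ⟨B', hB0', hB'⟩ := hq
    refine ⟨B + B', by positivity, fun s z hs hz => ?_⟩
    rw [Polynomial.evalEval_add]
    exact (ν.add_le _ _).trans (add_le_add (hB s z hs hz) (hB' s z hs hz))
  | monomial n a =>
    obtain ⟨B, hB0, hB⟩ := ν.exists_bound_eval a R
    refine ⟨B * |R| ^ n, by positivity, fun s z hs hz => ?_⟩
    rw [Polynomial.evalEval, Polynomial.eval_monomial, Polynomial.eval_mul, Polynomial.eval_pow,
      Polynomial.eval_C, map_mul, map_pow]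
    gcongr
    · exact hB s hs
    · exact hz.trans (le_abs_self R)

theorem AbsoluteValue.exists_bound_eval_of_X_pow_dvd (ν : AbsoluteValue L ℝ) {p : Polynomial L}
    {N : ℕ} (hp : Polynomial.X ^ N ∣ p) (R : ℝ) :
    ∃ B, 0 ≤ B ∧ ∀ s, ν s ≤ R → ν (p.eval s) ≤ B * ν s ^ N := by
  obtain ⟨r, rfl⟩ := hp
  obtain ⟨B, hB0, hB⟩ := ν.exists_bound_eval r R
  refine ⟨B, hB0, fun s hs => ?_⟩
  rw [Polynomial.eval_mul, Polynomial.eval_pow, Polynomial.eval_X, map_mul, map_pow, mul_comm]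
  gcongr
  exact hB s hs

theorem PowerSeries.X_pow_dvd_sub_trunc (φ : PowerSeries L) (N : ℕ) :
    PowerSeries.X ^ N ∣ φ - (PowerSeries.trunc N φ : PowerSeries L) := by
  rw [PowerSeries.X_pow_dvd_iff]
  intro m hm
  rw [map_sub, Polynomial.coeff_coe, PowerSeries.coeff_trunc, if_pos hm, sub_self]

theorem Polynomial.X_pow_dvd_of_coe {p : Polynomial L} {N : ℕ}
    (h : PowerSeries.X ^ N ∣ (p : PowerSeries L)) : Polynomial.X ^ N ∣ p := by
  rw [PowerSeries.X_pow_dvd_iff] at h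
  rw [Polynomial.X_pow_dvd_iff]
  intro m hm
  rw [← Polynomial.coeff_coe, h m hm]

theorem expand_evalEval (f : Polynomial (Polynomial L)) (e : ℕ) (s z : L) :
    (f.map (Polynomial.expand L e).toRingHom).evalEval s z = f.evalEval (s ^ e) z := by
  induction f using Polynomial.induction_on' with
  | add p q hp hq => rw [Polynomial.map_add, Polynomial.evalEval_add, Polynomial.evalEval_add,
      hp, hq]
  | monomial n a => simp [Polynomial.evalEval, Polynomial.expand_eval]

theorem exists_expand_eq_prod_trunc_add {f : Polynomial (Polynomial L)} {e : ℕ}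
    {Φ : Multiset (PowerSeries L)} (hΦ : f.map (expandPowerSeries L e) =
      (Φ.map fun φ => Polynomial.X - Polynomial.C φ).prod) (M : ℕ) :
    ∃ R : Polynomial (Polynomial L), f.map (Polynomial.expand L e).toRingHom =
      (Φ.map fun φ => Polynomial.X - Polynomial.C (PowerSeries.trunc M φ)).prod +
        Polynomial.C (Polynomial.X ^ M) * R := by
  set g := f.map (Polynomial.expand L e).toRingHom -
    (Φ.map fun φ => Polynomial.X - Polynomial.C (PowerSeries.trunc M φ)).prod with hg
  have h : Polynomial.C (Polynomial.X ^ M) ∣ g := by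
    rw [Polynomial.C_dvd_iff_dvd_coeff]
    intro i
    apply Polynomial.X_pow_dvd_of_coe
    rw [← Ideal.mem_span_singleton, ← Ideal.Quotient.eq_zero_iff_mem]
    set π := Ideal.Quotient.mk (Ideal.span {(PowerSeries.X ^ M : PowerSeries L)})
    have h1 : (g.map Polynomial.coeToPowerSeries.ringHom).map π = 0 := by
      rw [hg, Polynomial.map_sub, Polynomial.map_sub,
        Polynomial.map_map (f := (Polynomial.expand L e).toRingHom)]
      change (f.map (expandPowerSeries L e)).map π - _ = 0
      rw [hΦ, Polynomial.map_multiset_prod, Polynomial.map_multiset_prod,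
        Polynomial.map_multiset_prod, Multiset.map_map, Multiset.map_map, Multiset.map_map,
        sub_eq_zero]
      congr 1
      refine Multiset.map_congr rfl fun φ _ => ?_
      have h2 : π φ = π (PowerSeries.trunc M φ : PowerSeries L) :=
        Ideal.Quotient.eq.2 (Ideal.mem_span_singleton.2 (φ.X_pow_dvd_sub_trunc M))
      simp [h2]
    have h2 := congrArg (fun p => Polynomial.coeff p i) h1
    simpa using h2
  obtain ⟨R, hR⟩ := h
  exact ⟨R, by rw [← hR, hg]; ring⟩


theorem AbsoluteValue.exists_bound_of_evalEval_eq_zero (ν : AbsoluteValue L ℝ)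
    {f : Polynomial (Polynomial L)} (hf : f.Monic) (R : ℝ) :
    ∃ B, 0 ≤ B ∧ ∀ s z, ν s ≤ R → f.evalEval s z = 0 → ν z ≤ B := by
  choose B hB0 hB using fun i => ν.exists_bound_eval (f.coeff i) R
  have hE : ∀ s, ν s ≤ R → ∀ i, ν ((f.map (Polynomial.evalRingHom s)).coeff i) ≤
      1 + ∑ i ∈ Finset.range (f.natDegree + 1), B i := by
    intro s hs i
    rw [Polynomial.coeff_map, Polynomial.coe_evalRingHom]
    have h0 : 0 ≤ ∑ i ∈ Finset.range (f.natDegree + 1), B i := Finset.sum_nonneg fun i _ => hB0 i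
    by_cases hi : i < f.natDegree + 1
    · have := Finset.single_le_sum (f := B) (fun i _ => hB0 i) (Finset.mem_range.2 hi)
      linarith [hB i s hs]
    · rw [Polynomial.coeff_eq_zero_of_natDegree_lt (by omega), Polynomial.eval_zero, map_zero]
      linarith
  have h1 : (1 : ℝ) ≤ 1 + ∑ i ∈ Finset.range (f.natDegree + 1), B i :=
    le_add_of_nonneg_right (Finset.sum_nonneg fun i _ => hB0 i)
  refine ⟨(1 + ∑ i ∈ Finset.range (f.natDegree + 1), B i) * (f.natDegree + 1), by positivity,
    fun s z hs hz => ?_⟩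
  have h2 := ν.le_of_monic_root (hf.map (Polynomial.evalRingHom s)) h1 (hE s hs)
    (w := z) (by rwa [Polynomial.map_evalRingHom_eval])
  rwa [hf.natDegree_map] at h2

theorem exists_root_approx {ν : AbsoluteValue L ℝ} {f : Polynomial (Polynomial L)} (hf : f.Monic)
    {e : ℕ} {Φ : Multiset (PowerSeries L)} (hΦ : f.map (expandPowerSeries L e) =
      (Φ.map fun φ => Polynomial.X - Polynomial.C φ).prod) (R : ℝ) (N : ℕ) :
    ∃ B, 0 ≤ B ∧ ∀ s z, ν s ≤ R → f.evalEval (s ^ e) z = 0 →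
      ∃ φ ∈ Φ, ν (z - (PowerSeries.trunc N φ).eval s) ≤ B * ν s ^ N := by
  obtain ⟨B₁, hB₁0, hB₁⟩ := ν.exists_bound_of_evalEval_eq_zero hf (|R| ^ e)
  obtain ⟨r, hr⟩ := exists_expand_eq_prod_trunc_add hΦ (Φ.card * N)
  obtain ⟨B₂, hB₂0, hB₂⟩ := ν.exists_bound_evalEval r (max R B₁)
  have h3 : ∀ φ : PowerSeries L, ∃ B, 0 ≤ B ∧ (Φ.card ≠ 0 → ∀ s, ν s ≤ R →
      ν ((PowerSeries.trunc (Φ.card * N) φ - PowerSeries.trunc N φ).eval s) ≤ B * ν s ^ N) := by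
    intro φ
    by_cases h : Φ.card = 0
    · exact ⟨0, le_rfl, fun h' => absurd h h'⟩
    obtain ⟨B, hB0, hB⟩ := ν.exists_bound_eval_of_X_pow_dvd (N := N)
      (p := PowerSeries.trunc (Φ.card * N) φ - PowerSeries.trunc N φ) (by
        rw [Polynomial.X_pow_dvd_iff]
        intro d hd
        have : N ≤ Φ.card * N := Nat.le_mul_of_pos_left N (Nat.pos_of_ne_zero h)
        rw [Polynomial.coeff_sub, PowerSeries.coeff_trunc, PowerSeries.coeff_trunc, if_pos hd,
          if_pos (by omega), sub_self]) R
    exact ⟨B, hB0, fun _ => hB⟩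
  choose B₃ hB₃0 hB₃ using h3
  refine ⟨1 + B₂ + (Φ.map B₃).sum, ?_, fun s z hs hz => ?_⟩
  · have : 0 ≤ (Φ.map B₃).sum := Multiset.sum_nonneg (by simpa using fun φ _ => hB₃0 φ)
    positivity
  have hz1 : ν z ≤ B₁ := hB₁ (s ^ e) z (by
    rw [map_pow]; gcongr; exact hs.trans (le_abs_self R)) hz
  have hprod : (Φ.map fun φ => ν (z - (PowerSeries.trunc (Φ.card * N) φ).eval s)).prod ≤
      B₂ * (ν s ^ N) ^ Φ.card := by
    have h := congrArg (Polynomial.evalEval s z) hr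
    rw [expand_evalEval, hz, Polynomial.evalEval_add, Polynomial.evalEval_mul,
      ← Polynomial.coe_evalEvalRingHom, map_multiset_prod, Multiset.map_map,
      Polynomial.coe_evalEvalRingHom] at h
    have h' : (Φ.map fun φ => (z - (PowerSeries.trunc (Φ.card * N) φ).eval s)).prod =
        - (s ^ (Φ.card * N) * r.evalEval s z) := by
      rw [eq_neg_iff_add_eq_zero, h]
      simp [Polynomial.evalEval]
    have h2 := congrArg ν h'
    rw [map_multiset_prod, Multiset.map_map, ν.map_neg, map_mul, map_pow] at h2
    refine h2.le.trans ?_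
    rw [mul_comm, ← pow_mul, mul_comm N]
    gcongr
    exact hB₂ s z (hs.trans (le_max_left _ _)) (hz1.trans (le_max_right _ _))
  have hcard : Φ.card ≠ 0 := by
    intro h0
    rw [Multiset.card_eq_zero] at h0
    subst h0
    rw [Multiset.map_zero, Multiset.prod_zero] at hΦ
    have hf1 : f = 1 := hf.natDegree_eq_zero.1 (by
      rw [← hf.natDegree_map (expandPowerSeries L e), hΦ, Polynomial.natDegree_one])
    rw [hf1] at hz
    simp at hz
  have hex : ∃ φ ∈ Φ, ν (z - (PowerSeries.trunc (Φ.card * N) φ).eval s) ≤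
      (1 + B₂) * ν s ^ N := by
    by_contra! hcon
    rcases (pow_nonneg (ν.nonneg s) N).eq_or_lt with h0 | hpos
    · rw [← h0, zero_pow hcard, mul_zero] at hprod
      refine hprod.not_gt (Multiset.prod_pos ?_)
      simp only [Multiset.mem_map]
      rintro _ ⟨φ, hφ, rfl⟩
      have := hcon φ hφ
      rwa [← h0, mul_zero] at this
    · have h := Multiset.prod_map_le_prod_map₀ (s := Φ) (fun _ => (1 + B₂) * ν s ^ N)
        (fun φ => ν (z - (PowerSeries.trunc (Φ.card * N) φ).eval s)) (fun φ _ => by positivity)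
        (fun φ hφ => (hcon φ hφ).le)
      rw [Multiset.map_const', Multiset.prod_replicate, mul_pow] at h
      have h1 : 1 + B₂ ≤ (1 + B₂) ^ Φ.card := le_self_pow₀ (by linarith) hcard
      have h2 : 0 < (ν s ^ N) ^ Φ.card := by positivity
      nlinarith
  obtain ⟨φ, hφ, h⟩ := hex
  refine ⟨φ, hφ, ?_⟩
  have h4 := hB₃ φ (by rintro h0; simp [Multiset.card_eq_zero.1 h0] at hφ) s hs
  have h5 : B₃ φ ≤ (Φ.map B₃).sum := Multiset.single_le_sum (by simpa using fun φ _ => hB₃0 φ) _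
    (Multiset.mem_map_of_mem _ hφ)
  calc ν (z - (PowerSeries.trunc N φ).eval s) =
      ν ((z - (PowerSeries.trunc (Φ.card * N) φ).eval s) +
        (PowerSeries.trunc (Φ.card * N) φ - PowerSeries.trunc N φ).eval s) := by
        rw [Polynomial.eval_sub]; congr 1; ring
    _ ≤ (1 + B₂) * ν s ^ N + B₃ φ * ν s ^ N := (ν.add_le _ _).trans (add_le_add h h4)
    _ ≤ (1 + B₂) * ν s ^ N + (Φ.map B₃).sum * ν s ^ N := by gcongr
    _ = _ := by ring

end Approximation

section Pairs

theorem AbsoluteValue.exists_bound_mul_approx {L : Type*} [Field L] (ν : AbsoluteValue L ℝ) (l : L)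
    (φ φ' : PowerSeries L) (N : ℕ) (R B₁ B₂ : ℝ) (hB₁ : 0 ≤ B₁) (hB₂ : 0 ≤ B₂) :
    ∃ B, 0 ≤ B ∧ ∀ s z z', ν s ≤ R → ν z' ≤ B₁ →
      ν (z - (PowerSeries.trunc N φ).eval s) ≤ B₂ * ν s ^ N →
      ν (z' - (PowerSeries.trunc N φ').eval s) ≤ B₂ * ν s ^ N →
      ν ((l - z) * (l - z') - (PowerSeries.trunc N
        ((PowerSeries.C l - φ) * (PowerSeries.C l - φ'))).eval s) ≤ B * ν s ^ N := by
  obtain ⟨B₃, hB₃0, hB₃⟩ := ν.exists_bound_eval (PowerSeries.trunc N φ) R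
  obtain ⟨B₄, hB₄0, hB₄⟩ := ν.exists_bound_eval_of_X_pow_dvd (N := N)
    (p := (Polynomial.C l - PowerSeries.trunc N φ) * (Polynomial.C l - PowerSeries.trunc N φ') -
      PowerSeries.trunc N ((PowerSeries.C l - φ) * (PowerSeries.C l - φ'))) (by
      apply Polynomial.X_pow_dvd_of_coe
      obtain ⟨r, hr⟩ := φ.X_pow_dvd_sub_trunc N
      obtain ⟨r', hr'⟩ := φ'.X_pow_dvd_sub_trunc N
      obtain ⟨r'', hr''⟩ :=
        ((PowerSeries.C l - φ) * (PowerSeries.C l - φ')).X_pow_dvd_sub_trunc N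
      refine ⟨r * (PowerSeries.C l - φ') + (PowerSeries.C l - φ + PowerSeries.X ^ N * r) * r' + r'',
        ?_⟩
      push_cast
      rw [mul_add, ← hr'', mul_add, ← mul_assoc, ← hr, mul_left_comm, ← hr']
      ring) R
  refine ⟨B₂ * (ν l + B₁) + (ν l + B₃) * B₂ + B₄, by positivity, fun s z z' hs hz' h h' => ?_⟩
  have h4 := hB₄ s hs
  have h3 := hB₃ s hs
  simp only [Polynomial.eval_sub, Polynomial.eval_mul, Polynomial.eval_C] at h4
  set t := (PowerSeries.trunc N φ).eval s
  set t' := (PowerSeries.trunc N φ').eval s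
  set T := (PowerSeries.trunc N ((PowerSeries.C l - φ) * (PowerSeries.C l - φ'))).eval s
  have hsub : ∀ x y, ν (x - y) ≤ ν x + ν y := fun x y => by
    rw [sub_eq_add_neg, ← ν.map_neg y]; exact ν.add_le _ _
  have h5 : ν ((z - t) * (l - z')) ≤ B₂ * ν s ^ N * (ν l + B₁) := by
    rw [map_mul]
    gcongr
    exact (hsub _ _).trans (by gcongr)
  have h6 : ν ((l - t) * (z' - t')) ≤ (ν l + B₃) * (B₂ * ν s ^ N) := by
    rw [map_mul]
    gcongr
    exact (hsub _ _).trans (by gcongr)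
  calc ν ((l - z) * (l - z') - T) =
      ν (((l - t) * (l - t') - T - (z - t) * (l - z')) - (l - t) * (z' - t')) := by
        congr 1; ring
    _ ≤ B₄ * ν s ^ N + B₂ * ν s ^ N * (ν l + B₁) + (ν l + B₃) * (B₂ * ν s ^ N) :=
      (hsub _ _).trans (add_le_add ((hsub _ _).trans (add_le_add h4 h5)) h6)
    _ = _ := by ring

variable {k L : Type*} [Field k] [NumberField k] [Field L] [CharZero L] [Algebra k L]
  [Algebra.IsAlgebraic k L]

theorem exists_polynomial_pair {ν : AbsoluteValue L ℝ} (hν : IsLiouvilleAbs k ν) {q : k}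
    (hq0 : q ≠ 0) (hq : ν (algebraMap k L q) < 1) {κ : L} (hκ : κ ≠ 0)
    {f : Polynomial (Polynomial L)} (hf : f.Monic) {e : ℕ} {Φ : Multiset (PowerSeries L)}
    (hΦ : f.map (expandPowerSeries L e) = (Φ.map fun φ => Polynomial.X - Polynomial.C φ).prod)
    {z z' : ℕ → L} {a b : ℕ → k} {C D : ℕ}
    (hz : ∀ m, f.evalEval ((κ * algebraMap k L q ^ m) ^ e) (z m) = 0)
    (hz' : ∀ m, f.evalEval ((κ * algebraMap k L q ^ m) ^ e) (z' m) = 0)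
    (ha : ∀ m, z m + z' m = algebraMap k L (a m)) (hb : ∀ m, z m * z' m = algebraMap k L (b m))
    (hs : ∀ m, SizeLE (C * D ^ m) (z m)) (hs' : ∀ m, SizeLE (C * D ^ m) (z' m)) :
    ∃ φ ∈ Φ, ∃ φ' ∈ Φ, ∃ A B : Polynomial L, φ + φ' = A ∧ φ * φ' = B := by
  classical
  have hσ : ∀ m, ν (κ * algebraMap k L q ^ m) ≤ ν κ := fun m => by
    rw [map_mul, map_pow]
    exact mul_le_of_le_one_right (ν.nonneg _) (pow_le_one₀ (ν.nonneg _) hq.le)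
  have key : ∀ l : ℕ, ∃ c : Φ.toFinset × Φ.toFinset, ∃ g : Polynomial L,
      (PowerSeries.C (l : L) - (c.1 : PowerSeries L)) *
        (PowerSeries.C (l : L) - (c.2 : PowerSeries L)) = g := by
    intro l
    have hy : ∀ m, algebraMap k L ((l : k) ^ 2 - l * a m + b m) = (l - z m) * (l - z' m) := by
      intro m
      rw [map_add, map_sub, map_mul, ← ha, ← hb, map_pow, map_natCast]
      ring
    refine exists_eq_polynomial_of_approx hν hq0 hq hκ
      (y := fun m => (l : k) ^ 2 - l * a m + b m)
      (C := (2 * ((l + 1) * C)) ^ 2) (D := D ^ 2) (fun m => ?_)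
      (fun c : Φ.toFinset × Φ.toFinset => (PowerSeries.C (l : L) - (c.1 : PowerSeries L)) *
        (PowerSeries.C (l : L) - (c.2 : PowerSeries L))) (fun N => ?_)
    · have h := ((SizeLE.natCast l).add (hs m).neg).mul ((SizeLE.natCast l).add (hs' m).neg)
      rw [hy, sub_eq_add_neg, sub_eq_add_neg]
      convert h using 1
      ring
    · obtain ⟨B₁, hB₁0, hB₁⟩ := ν.exists_bound_of_evalEval_eq_zero hf (ν κ ^ e)
      obtain ⟨B₂, hB₂0, hB₂⟩ := exists_root_approx (ν := ν) hf hΦ (ν κ) N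
      choose B hB0 hB using fun c : Φ.toFinset × Φ.toFinset =>
        ν.exists_bound_mul_approx (l : L) c.1 c.2 N (ν κ) B₁ B₂ hB₁0 hB₂0
      refine ⟨(∑ c, B c) * ν κ ^ N, fun m => ?_⟩
      obtain ⟨φ, hφ, h⟩ := hB₂ _ _ (hσ m) (hz m)
      obtain ⟨φ', hφ', h'⟩ := hB₂ _ _ (hσ m) (hz' m)
      refine ⟨(⟨φ, Multiset.mem_toFinset.2 hφ⟩, ⟨φ', Multiset.mem_toFinset.2 hφ'⟩), ?_⟩
      rw [hy]
      refine (hB _ _ _ _ (hσ m) (hB₁ _ _ (by rw [map_pow]; gcongr; exact hσ m) (hz' m)) h h').trans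
        ?_
      rw [map_mul, map_pow, mul_pow, mul_assoc, ← pow_mul, mul_comm m N]
      gcongr
      exact Finset.single_le_sum (f := B) (fun c _ => hB0 c) (Finset.mem_univ _)
  choose c g hg using key
  obtain ⟨l, l', hll, hc⟩ := Finite.exists_ne_map_eq_of_infinite c
  have h1 := hg l
  have h2 := hg l'
  rw [← hc] at h2
  set φ := ((c l).1 : PowerSeries L) with hφ
  set φ' := ((c l).2 : PowerSeries L) with hφ'
  have hne : (l : L) - l' ≠ 0 := sub_ne_zero.2 (by exact_mod_cast hll)
  have hinv : (PowerSeries.C ((l : L) - l')⁻¹) * (PowerSeries.C (l : L) - PowerSeries.C (l' : L))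
      = 1 := by
    rw [← map_sub, ← map_mul, inv_mul_cancel₀ hne, map_one]
  have hA : φ + φ' = ((Polynomial.C (l : L) + Polynomial.C (l' : L) -
      Polynomial.C ((l : L) - l')⁻¹ * (g l - g l') : Polynomial L) : PowerSeries L) := by
    push_cast
    rw [← h1, ← h2]
    linear_combination (PowerSeries.C (l : L) + PowerSeries.C (l' : L) - (φ + φ')) * hinv
  refine ⟨φ, Multiset.mem_toFinset.1 (c l).1.2, φ', Multiset.mem_toFinset.1 (c l).2.2, _,
    g l - Polynomial.C (l : L) ^ 2 + Polynomial.C (l : L) * (Polynomial.C (l : L) +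
      Polynomial.C (l' : L) - Polynomial.C ((l : L) - l')⁻¹ * (g l - g l')), hA, ?_⟩
  rw [Polynomial.coe_add, Polynomial.coe_mul, ← hA, Polynomial.coe_sub, ← h1]
  push_cast
  ring

end Pairs

section SmoothQuartic

theorem aeval_mul_of_isHomogeneous {ι R S : Type*} [Fintype ι] [CommSemiring R]
    [CommSemiring S] [Algebra R S] {F : MvPolynomial ι R} {n : ℕ} (hF : F.IsHomogeneous n) (c : S)
    (P : ι → S) : aeval (fun i => c * P i) F = c ^ n * aeval P F := by
  rw [aeval_def, aeval_def, eval₂_eq', eval₂_eq', Finset.mul_sum]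
  refine Finset.sum_congr rfl fun d hd => ?_
  have h := hF (mem_support_iff.1 hd)
  rw [Finsupp.weight_apply, Finsupp.sum_fintype _ _ (by simp)] at h
  simp only [Pi.one_apply, smul_eq_mul, mul_one] at h
  simp only [mul_pow, Finset.prod_mul_distrib, Finset.prod_pow_eq_pow_sum, h]
  ring

theorem derivative_aeval {ι L : Type*} [Fintype ι] [Field L] (Q : ι → Polynomial L)
    (F : MvPolynomial ι L) :
    Polynomial.derivative (aeval Q F) =
      ∑ i, aeval Q (pderiv i F) * Polynomial.derivative (Q i) := by
  classical
  induction F using MvPolynomial.induction_on with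
  | C a => simp
  | add p q hp hq => simp only [map_add, hp, hq, add_mul, Finset.sum_add_distrib]
  | mul_X p i hp =>
    simp only [map_mul, aeval_X, Polynomial.derivative_mul, hp, pderiv_mul, pderiv_X, map_add,
      add_mul, Finset.sum_add_distrib, Finset.sum_mul]
    refine congrArg₂ (· + ·) (Finset.sum_congr rfl fun j _ => by ring) ?_
    · rw [Finset.sum_eq_single i]
      · simp
      · intro j _ hj
        simp [Pi.single_eq_of_ne (Ne.symm hj)]
      · simp

theorem coeff_aeval_of_isHomogeneous {ι L : Type*} [Fintype ι] [Field L]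
    {F : MvPolynomial ι L} {d : ℕ} (hF : F.IsHomogeneous d) {Q : ι → Polynomial L} {n : ℕ}
    (hQ : ∀ i, (Q i).natDegree ≤ n) :
    (aeval Q F).coeff (d * n) = eval (fun i => (Q i).coeff n) F := by
  rw [aeval_def, eval₂_eq', eval_eq', Polynomial.finsetSum_coeff]
  refine Finset.sum_congr rfl fun m hm => ?_
  have h := hF (mem_support_iff.1 hm)
  rw [Finsupp.weight_apply, Finsupp.sum_fintype _ _ (by simp)] at h
  simp only [Pi.one_apply, smul_eq_mul, mul_one] at h
  rw [Polynomial.algebraMap_eq, Polynomial.coeff_C_mul, ← h]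
  have key : ∀ s : Finset ι, (∏ i ∈ s, Q i ^ m i).natDegree ≤ (∑ i ∈ s, m i) * n ∧
      (∏ i ∈ s, Q i ^ m i).coeff ((∑ i ∈ s, m i) * n) = ∏ i ∈ s, (Q i).coeff n ^ m i := by
    classical
    intro s
    induction s using Finset.induction_on with
    | empty => simp
    | insert i s hi ih =>
      have h1 : (Q i ^ m i).natDegree ≤ m i * n :=
        Polynomial.natDegree_pow_le_of_le _ (hQ i)
      rw [Finset.prod_insert hi, Finset.sum_insert hi, Finset.prod_insert hi, add_mul]
      exact ⟨Polynomial.natDegree_mul_le_of_le h1 ih.1, by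
        rw [Polynomial.coeff_mul_add_eq_of_natDegree_le h1 ih.1,
          Polynomial.coeff_pow_of_natDegree_le (hQ i), ih.2]⟩
  rw [(key Finset.univ).2]

theorem exists_cross_eq_mul {R : Type*} [CommRing R] {n₀ n₁ n₂ q₀ q₁ q₂ d₀ d₁ d₂ u₀ u₁ u₂ : R}
    (hq : n₀ * q₀ + n₁ * q₁ + n₂ * q₂ = 0) (hd : n₀ * d₀ + n₁ * d₁ + n₂ * d₂ = 0)
    (hu : u₀ * n₀ + u₁ * n₁ + u₂ * n₂ = 1) :
    ∃ m, q₁ * d₂ - q₂ * d₁ = m * n₀ ∧ q₂ * d₀ - q₀ * d₂ = m * n₁ ∧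
      q₀ * d₁ - q₁ * d₀ = m * n₂ := by
  have h01 : n₀ * (q₂ * d₀ - q₀ * d₂) = n₁ * (q₁ * d₂ - q₂ * d₁) := by
    linear_combination q₂ * hd - d₂ * hq
  have h12 : n₁ * (q₀ * d₁ - q₁ * d₀) = n₂ * (q₂ * d₀ - q₀ * d₂) := by
    linear_combination q₀ * hd - d₀ * hq
  have h20 : n₂ * (q₁ * d₂ - q₂ * d₁) = n₀ * (q₀ * d₁ - q₁ * d₀) := by
    linear_combination q₁ * hd - d₁ * hq
  generalize q₁ * d₂ - q₂ * d₁ = w₀ at *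
  generalize q₂ * d₀ - q₀ * d₂ = w₁ at *
  generalize q₀ * d₁ - q₁ * d₀ = w₂ at *
  refine ⟨u₀ * w₀ + u₁ * w₁ + u₂ * w₂, ?_, ?_, ?_⟩
  · linear_combination -w₀ * hu - u₁ * h01 + u₂ * h20
  · linear_combination -w₁ * hu + u₀ * h01 - u₂ * h12
  · linear_combination -w₂ * hu - u₀ * h20 + u₁ * h12

variable {L : Type*} [Field L]

theorem Polynomial.exists_eq_mul_coprime {ι : Type*} [Fintype ι] {P : ι → Polynomial L}
    (hP : P ≠ 0) : ∃ (g : Polynomial L) (Q : ι → Polynomial L), g ≠ 0 ∧ (∀ i, P i = g * Q i) ∧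
      ∀ x, ∃ i, (Q i).eval x ≠ 0 := by
  obtain ⟨g, hg⟩ := (IsPrincipalIdealRing.principal (Ideal.span (Set.range P))).principal
  have hdvd : ∀ i, g ∣ P i := fun i => by
    rw [← Ideal.mem_span_singleton, ← Ideal.submodule_span_eq, ← hg]
    exact Ideal.subset_span ⟨i, rfl⟩
  choose Q hQ using hdvd
  have hg0 : g ≠ 0 := by
    rintro rfl
    exact hP (_root_.funext fun i => by rw [hQ, zero_mul, Pi.zero_apply])
  have hmem : g ∈ Ideal.span (Set.range P) := by
    rw [hg, Ideal.submodule_span_eq]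
    exact Ideal.mem_span_singleton_self g
  rw [Ideal.mem_span_range_iff_exists_fun] at hmem
  obtain ⟨u, hu⟩ := hmem
  have h1 : ∑ i, u i * Q i = 1 := by
    apply mul_left_cancel₀ hg0
    rw [Finset.mul_sum, mul_one]
    conv_rhs => rw [← hu]
    exact Finset.sum_congr rfl fun i _ => by rw [hQ]; ring
  refine ⟨g, Q, hg0, hQ, fun x => ?_⟩
  by_contra! hx
  have h2 := congrArg (Polynomial.eval x) h1
  rw [Polynomial.eval_finsetSum, Finset.sum_eq_zero] at h2
  · simp at h2
  · intro i _
    rw [Polynomial.eval_mul, hx, mul_zero]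

variable [IsAlgClosed L]

theorem Polynomial.exists_sum_mul_eq_one {ι : Type*} [Fintype ι] {N : ι → Polynomial L}
    (hN : ∀ x, ∃ i, (N i).eval x ≠ 0) : ∃ u : ι → Polynomial L, ∑ i, u i * N i = 1 := by
  obtain ⟨g, hg⟩ := (IsPrincipalIdealRing.principal (Ideal.span (Set.range N))).principal
  have hdvd : ∀ i, g ∣ N i := fun i => by
    rw [← Ideal.mem_span_singleton, ← Ideal.submodule_span_eq, ← hg]
    exact Ideal.subset_span ⟨i, rfl⟩
  have hunit : IsUnit g := by
    by_contra hu
    obtain ⟨x, hx⟩ : ∃ x, g.eval x = 0 := by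
      by_cases hg0 : g = 0
      · exact ⟨0, by rw [hg0, Polynomial.eval_zero]⟩
      · exact IsAlgClosed.exists_root g fun h => hu (Polynomial.isUnit_iff_degree_eq_zero.2 h)
    obtain ⟨i, hi⟩ := hN x
    obtain ⟨r, hr⟩ := hdvd i
    exact hi (by rw [hr, Polynomial.eval_mul, hx, zero_mul])
  have h1 : (1 : Polynomial L) ∈ Ideal.span (Set.range N) := by
    rw [hg, Ideal.submodule_span_eq, Ideal.mem_span_singleton]
    exact hunit.dvd
  rw [Ideal.mem_span_range_iff_exists_fun] at h1
  exact h1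

/-- A smooth plane quartic has no nonconstant polynomial parametrization. -/
theorem mul_derivative_eq_of_aeval_eq_zero {F : MvPolynomial (Fin 3) L}
    (hF : F.IsHomogeneous 4) (hsm : ∀ P : Fin 3 → L, P ≠ 0 → ∃ i, eval P (pderiv i F) ≠ 0)
    {P : Fin 3 → Polynomial L} (hP : aeval P F = 0) (i j : Fin 3) :
    P i * Polynomial.derivative (P j) = P j * Polynomial.derivative (P i) := by
  by_cases hP0 : P = 0
  · simp [hP0]
  obtain ⟨g, Q, hg0, hPQ, hQ⟩ := Polynomial.exists_eq_mul_coprime hP0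
  have hFQ : aeval Q F = 0 := by
    rw [show P = fun i => g * Q i from _root_.funext hPQ, aeval_mul_of_isHomogeneous hF] at hP
    exact (mul_eq_zero.1 hP).resolve_left (pow_ne_zero _ hg0)
  set N : Fin 3 → Polynomial L := fun i => aeval Q (pderiv i F) with hN
  have hNx : ∀ x, ∃ i, (N i).eval x ≠ 0 := by
    intro x
    have hQx : (fun i => (Q i).eval x) ≠ 0 := by
      obtain ⟨i, hi⟩ := hQ x
      exact fun h => hi (congrFun h i)
    obtain ⟨i, hi⟩ := hsm _ hQx
    refine ⟨i, ?_⟩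
    have h : ((Polynomial.aeval x).comp (aeval Q)) (pderiv i F) =
        eval (fun i => (Q i).eval x) (pderiv i F) := by
      rw [comp_aeval, ← aeval_eq_eval]
      simp only [Polynomial.coe_aeval_eq_eval]
    rw [← h] at hi
    simpa using hi
  obtain ⟨u, hu⟩ := Polynomial.exists_sum_mul_eq_one hNx
  have e1 : ∑ i, N i * Q i = 0 := by
    have h := congrArg (aeval Q) hF.sum_X_mul_pderiv
    rw [map_sum, map_nsmul, hFQ, smul_zero] at h
    rw [← h]
    exact Finset.sum_congr rfl fun i _ => by rw [map_mul, aeval_X, mul_comm]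
  have e2 : ∑ i, N i * Polynomial.derivative (Q i) = 0 := by
    rw [← derivative_aeval, hFQ, Polynomial.derivative_zero]
  rw [Fin.sum_univ_three] at e1 e2 hu
  obtain ⟨m, h0, h1, h2⟩ := exists_cross_eq_mul e1 e2 hu
  suffices hm : m = 0 by
    rw [hm, zero_mul, sub_eq_zero] at h0 h1 h2
    have h : Q i * Polynomial.derivative (Q j) = Q j * Polynomial.derivative (Q i) := by
      fin_cases i <;> fin_cases j
      exacts [rfl, h2, h1.symm, h2.symm, rfl, h0, h1, h0.symm, rfl]
    rw [hPQ i, hPQ j, Polynomial.derivative_mul, Polynomial.derivative_mul]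
    linear_combination g ^ 2 * h
  by_contra hm
  set n := Finset.univ.sup fun i => (Q i).natDegree with hn
  have hQn : ∀ i, (Q i).natDegree ≤ n := fun i =>
    Finset.le_sup (f := fun i => (Q i).natDegree) (Finset.mem_univ i)
  obtain ⟨i₀, -, hi₀⟩ := Finset.exists_mem_eq_sup Finset.univ Finset.univ_nonempty
    fun i => (Q i).natDegree
  rw [← hn] at hi₀
  have hn0 : n ≠ 0 := by
    intro hn0
    have hD : ∀ i, Polynomial.derivative (Q i) = 0 := fun i =>
      Polynomial.derivative_of_natDegree_zero (by have := hQn i; omega)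
    simp only [hD, mul_zero, sub_zero, zero_eq_mul] at h0 h1 h2
    rw [h0.resolve_left hm, h1.resolve_left hm, h2.resolve_left hm] at hu
    simp at hu
  have htop : (fun i => (Q i).coeff n) ≠ 0 := by
    intro h
    have h' : (Q i₀).coeff n = 0 := congrFun h i₀
    rw [hi₀, Polynomial.coeff_natDegree, Polynomial.leadingCoeff_eq_zero] at h'
    rw [h', Polynomial.natDegree_zero] at hi₀
    exact hn0 hi₀
  obtain ⟨l, hl⟩ := hsm _ htop
  rw [← coeff_aeval_of_isHomogeneous hF.pderiv hQn] at hl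
  have hWn : ∀ i j, (Q i * Polynomial.derivative (Q j) -
      Q j * Polynomial.derivative (Q i)).natDegree ≤ n + (n - 1) := by
    intro i j
    have hD : ∀ i, (Polynomial.derivative (Q i)).natDegree ≤ n - 1 := fun i =>
      (Polynomial.natDegree_derivative_le _).trans (Nat.sub_le_sub_right (hQn i) 1)
    exact (Polynomial.natDegree_sub_le _ _).trans (max_le
      (Polynomial.natDegree_mul_le_of_le (hQn i) (hD j))
      (Polynomial.natDegree_mul_le_of_le (hQn j) (hD i)))
  have hNl : N l ≠ 0 := fun h => hl (by change (N l).coeff _ = 0; rw [h, Polynomial.coeff_zero])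
  have hdeg : 3 * n ≤ (m * N l).natDegree := by
    rw [Polynomial.natDegree_mul hm hNl]
    have : (4 - 1) * n ≤ (N l).natDegree := Polynomial.le_natDegree_of_ne_zero hl
    omega
  have hdeg' : (m * N l).natDegree ≤ n + (n - 1) := by
    fin_cases l
    · exact h0 ▸ hWn 1 2
    · exact h1 ▸ hWn 2 0
    · exact h2 ▸ hWn 0 1
  omega

end SmoothQuartic

section AffinePart

/-- The dehomogenization `F(1, s, z)`, as a polynomial in `z` over the polynomials in `s`. -/
def affinePart {R : Type*} [CommRing R] (F : MvPolynomial (Fin 3) R) :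
    Polynomial (Polynomial R) :=
  aeval ![1, Polynomial.C Polynomial.X, Polynomial.X] F

section CommRing

variable {R : Type*} [CommRing R]

theorem affinePart_eval₂ {S : Type*} [CommRing S] [Algebra R S] (F : MvPolynomial (Fin 3) R)
    (s z : S) : (affinePart F).eval₂ (Polynomial.aeval s).toRingHom z = aeval ![1, s, z] F := by
  have h : ∀ F : MvPolynomial (Fin 3) R,
      ((Polynomial.eval₂RingHom (Polynomial.aeval (R := R) s).toRingHom z).comp
        (aeval ![1, Polynomial.C Polynomial.X, Polynomial.X] :
          MvPolynomial (Fin 3) R →ₐ[R] Polynomial (Polynomial R)).toRingHom) F =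
        (aeval ![1, s, z] : MvPolynomial (Fin 3) R →ₐ[R] S).toRingHom F := by
    intro F
    congr 1
    refine MvPolynomial.ringHom_ext (fun r => ?_) (fun i => ?_)
    · simp
    · fin_cases i <;> simp
  exact h F

theorem affinePart_evalEval (F : MvPolynomial (Fin 3) R) (s z : R) :
    (affinePart F).evalEval s z = eval ![1, s, z] F := by
  rw [← Polynomial.eval₂_evalRingHom, ← aeval_eq_eval]
  exact affinePart_eval₂ F s z

theorem affinePart_map {S : Type*} [CommRing S] (g : R →+* S) (F : MvPolynomial (Fin 3) R) :
    affinePart (map g F) = (affinePart F).map (Polynomial.mapRingHom g) := by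
  have h : ∀ F : MvPolynomial (Fin 3) R,
      ((aeval ![1, Polynomial.C Polynomial.X, Polynomial.X] :
          MvPolynomial (Fin 3) S →ₐ[S] Polynomial (Polynomial S)).toRingHom.comp (map g)) F =
      ((Polynomial.mapRingHom (Polynomial.mapRingHom g)).comp
        (aeval ![1, Polynomial.C Polynomial.X, Polynomial.X] :
          MvPolynomial (Fin 3) R →ₐ[R] Polynomial (Polynomial R)).toRingHom) F := by
    intro F
    congr 1
    refine MvPolynomial.ringHom_ext (fun r => ?_) (fun i => ?_)
    · simp
    · fin_cases i <;> simp
  exact h F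

theorem affinePart_eq_sum (F : MvPolynomial (Fin 3) R) :
    affinePart F = ∑ m ∈ F.support,
      Polynomial.monomial (m 2) (Polynomial.monomial (m 1) (coeff m F)) := by
  rw [affinePart, aeval_def, eval₂_eq']
  refine Finset.sum_congr rfl fun m _ => ?_
  rw [Fin.prod_univ_three, ← Polynomial.C_mul_X_pow_eq_monomial,
    ← Polynomial.C_mul_X_pow_eq_monomial]
  simp [mul_assoc]

theorem sum_eq_of_mem_support {F : MvPolynomial (Fin 3) R} {d : ℕ} (hF : F.IsHomogeneous d)
    {m : Fin 3 →₀ ℕ} (hm : m ∈ F.support) : m 0 + m 1 + m 2 = d := by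
  have h := hF (mem_support_iff.1 hm)
  rw [Finsupp.weight_apply, Finsupp.sum_fintype _ _ (by simp), Fin.sum_univ_three] at h
  simpa using h

theorem natDegree_affinePart_le {F : MvPolynomial (Fin 3) R} {d : ℕ} (hF : F.IsHomogeneous d) :
    (affinePart F).natDegree ≤ d := by
  rw [affinePart_eq_sum]
  refine Polynomial.natDegree_sum_le_of_forall_le _ _ fun m hm => ?_
  refine (Polynomial.natDegree_monomial_le _).trans ?_
  have := sum_eq_of_mem_support hF hm
  omega

theorem natDegree_coeff_affinePart_le {F : MvPolynomial (Fin 3) R} {d : ℕ}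
    (hF : F.IsHomogeneous d) (i : ℕ) : ((affinePart F).coeff i).natDegree ≤ d - i := by
  rw [affinePart_eq_sum, Polynomial.finsetSum_coeff]
  refine Polynomial.natDegree_sum_le_of_forall_le _ _ fun m hm => ?_
  rw [Polynomial.coeff_monomial]
  split_ifs with h
  · refine (Polynomial.natDegree_monomial_le _).trans ?_
    have := sum_eq_of_mem_support hF hm
    omega
  · simp

theorem coeff_coeff_affinePart {F : MvPolynomial (Fin 3) R} {d : ℕ} (hF : F.IsHomogeneous d)
    {m : Fin 3 →₀ ℕ} (hm : m ∈ F.support) :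
    ((affinePart F).coeff (m 2)).coeff (m 1) = coeff m F := by
  rw [affinePart_eq_sum, Polynomial.finsetSum_coeff, Polynomial.finsetSum_coeff,
    Finset.sum_eq_single m]
  · simp
  · intro m' hm' hne
    rw [Polynomial.coeff_monomial]
    split_ifs with h
    · rw [Polynomial.coeff_monomial, if_neg]
      intro h'
      apply hne
      have h1 := sum_eq_of_mem_support hF hm
      have h2 := sum_eq_of_mem_support hF hm'
      ext i
      fin_cases i
      · change m' 0 = m 0
        omega
      · exact h'
      · exact h
    · simp
  · exact fun h => absurd hm h

theorem three_le_natDegree_affinePart {F : MvPolynomial (Fin 3) R} (hF : F.IsHomogeneous 4)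
    (hsm : ∃ i, eval ![0, 0, 1] (pderiv i F) ≠ 0) : 3 ≤ (affinePart F).natDegree := by
  by_contra! hlt
  obtain ⟨i, hi⟩ := hsm
  apply hi
  rw [F.as_sum, map_sum, map_sum]
  refine Finset.sum_eq_zero fun m hm => ?_
  have h2 : m 2 ≤ (affinePart F).natDegree := by
    apply Polynomial.le_natDegree_of_ne_zero
    intro h
    have := coeff_coeff_affinePart hF hm
    rw [h, Polynomial.coeff_zero] at this
    exact mem_support_iff.1 hm this.symm
  have h4 := sum_eq_of_mem_support hF hm
  have h5 : m 0 + m 1 ≥ 2 := by omega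
  rw [pderiv_monomial, eval_monomial, Finsupp.prod_fintype _ _ (by simp), Fin.prod_univ_three]
  fin_cases i
  · rcases Nat.eq_zero_or_pos (m 0) with h | h
    · simp [h]
    · simp [← pow_add, zero_pow (show m 0 - 1 + m 1 ≠ 0 by omega)]
  · rcases Nat.eq_zero_or_pos (m 1) with h | h
    · simp [h]
    · simp [← pow_add, zero_pow (show m 0 + (m 1 - 1) ≠ 0 by omega)]
  · simp [← pow_add, zero_pow (show m 0 + m 1 ≠ 0 by omega)]

end CommRing

variable {L : Type*} [Field L] [IsAlgClosed L] [CharZero L]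

theorem affinePart_integralNormalization_eval₂_ne_zero {F : MvPolynomial (Fin 3) L}
    (hF : F.IsHomogeneous 4) (hsm : ∀ P : Fin 3 → L, P ≠ 0 → ∃ i, eval P (pderiv i F) ≠ 0)
    {e : ℕ} (he : 0 < e) (g : Polynomial L) :
    (affinePart F).integralNormalization.eval₂ (Polynomial.expand L e).toRingHom g ≠ 0 := by
  intro hg
  have h3 := three_le_natDegree_affinePart hF (hsm _ fun h => by simpa using congrFun h 2)
  set h := affinePart F with hh
  have h0 : h ≠ 0 := Polynomial.ne_zero_of_natDegree_gt h3
  set l := Polynomial.expand L e h.leadingCoeff with hl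
  have hl0 : l ≠ 0 := by
    rw [hl, Ne, Polynomial.expand_eq_zero he]
    exact Polynomial.leadingCoeff_ne_zero.2 h0
  set K := FractionRing (Polynomial L)
  set ι := algebraMap (Polynomial L) K
  have hιl : ι l ≠ 0 := by simpa [ι] using hl0
  have hS : (Polynomial.aeval (ι (Polynomial.X ^ e))).toRingHom =
      ι.comp (Polynomial.expand L e).toRingHom := by
    refine Polynomial.ringHom_ext (fun a => ?_) ?_
    · simp [ι, IsScalarTower.algebraMap_apply L (Polynomial L) K]
    · simp
  have h1 := Polynomial.integralNormalization_eval₂_leadingCoeff_mul (p := h) (by omega)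
    (ι.comp (Polynomial.expand L e).toRingHom) ((ι l)⁻¹ * ι g)
  have h2 : (ι.comp (Polynomial.expand L e).toRingHom) h.leadingCoeff = ι l := rfl
  rw [h2, mul_inv_cancel_left₀ hιl, ← Polynomial.hom_eval₂, hg, map_zero, zero_eq_mul] at h1
  have h4 := h1.resolve_left (pow_ne_zero _ hιl)
  rw [← hS, hh, affinePart_eval₂] at h4
  have h5 := aeval_mul_of_isHomogeneous hF (ι l) ![1, ι (Polynomial.X ^ e), (ι l)⁻¹ * ι g]
  rw [h4, mul_zero] at h5
  have h6 : (fun i => ι l * ![1, ι (Polynomial.X ^ e), (ι l)⁻¹ * ι g] i) =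
      fun i => ι (![l, l * Polynomial.X ^ e, g] i) := by
    funext i
    fin_cases i
    · simp
    · simp
    · simp [mul_inv_cancel_left₀ hιl]
  rw [h6] at h5
  have h7 : aeval ![l, l * Polynomial.X ^ e, g] F = 0 := by
    refine IsFractionRing.injective (Polynomial L) K ?_
    rw [map_zero, ← h5]
    exact (MvPolynomial.aeval_algebraMap_apply K ![l, l * Polynomial.X ^ e, g] F).symm
  have h8 := mul_derivative_eq_of_aeval_eq_zero hF hsm h7 0 1
  simp only [Matrix.cons_val_zero, Matrix.cons_val_one, Polynomial.derivative_mul,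
    Polynomial.derivative_X_pow] at h8
  have h9 : l ^ 2 * (Polynomial.C (e : L) * Polynomial.X ^ (e - 1)) = 0 := by
    linear_combination h8
  simp [hl0, he.ne'] at h9

theorem exists_eval_ne_zero_of_smooth {F : MvPolynomial (Fin 3) L}
    (hF : F.IsHomogeneous 4) (hsm : ∀ P : Fin 3 → L, P ≠ 0 → ∃ i, eval P (pderiv i F) ≠ 0)
    (s : L) : (affinePart F).map (Polynomial.evalRingHom s) ≠ 0 := by
  intro h
  have h1 : aeval ![1, Polynomial.C s, Polynomial.X] F = 0 := by
    rw [← affinePart_eval₂]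
    have : (Polynomial.aeval (Polynomial.C s)).toRingHom =
        (Polynomial.C).comp (Polynomial.evalRingHom s) := by
      refine Polynomial.ringHom_ext (fun a => by simp) (by simp)
    rw [this, ← Polynomial.eval₂_map, h, Polynomial.eval₂_zero]
  have h2 := mul_derivative_eq_of_aeval_eq_zero hF hsm h1 0 2
  simp at h2

end AffinePart

section PlaneQuartic

variable {L : Type*} [Field L]

theorem eq_of_eval_eq_of_ne_zero [Infinite L] {F M : MvPolynomial (Fin 3) L}
    (h : ∀ x y z : L, x ≠ 0 → eval ![x, y, z] F = eval ![x, y, z] M) : F = M := by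
  refine mul_left_cancel₀ (X_ne_zero (0 : Fin 3)) (MvPolynomial.funext fun P => ?_)
  rw [eval_mul, eval_mul, eval_X]
  by_cases h0 : P 0 = 0
  · simp [h0]
  · have hP : P = ![P 0, P 1, P 2] := by
      ext i
      fin_cases i <;> rfl
    rw [hP, h _ _ _ h0]

theorem eval_eq_of_isHomogeneous {F : MvPolynomial (Fin 3) L} (hF : F.IsHomogeneous 4)
    {x : L} (hx : x ≠ 0) (y z : L) :
    eval ![x, y, z] F = x ^ 4 * eval ![1, y / x, z / x] F := by
  have h := aeval_mul_of_isHomogeneous hF x ![1, y / x, z / x]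
  rw [aeval_eq_eval] at h
  refine Eq.trans ?_ h
  refine congrArg (fun P => eval P F) ?_
  ext i
  fin_cases i
  · simp
  · simp [mul_div_cancel₀ _ hx]
  · simp [mul_div_cancel₀ _ hx]

variable [IsAlgClosed L]

theorem exists_binary_form_zero {n : ℕ} (hn : n ≠ 0) (u : ℕ → L) :
    ∃ x y : L, (x ≠ 0 ∨ y ≠ 0) ∧ ∑ i ∈ Finset.range (n + 1), u i * x ^ (n - i) * y ^ i = 0 := by
  by_cases h : u n = 0
  · refine ⟨0, 1, by simp, Finset.sum_eq_zero fun i hi => ?_⟩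
    rcases (Nat.lt_succ_iff.1 (Finset.mem_range.1 hi)).eq_or_lt with rfl | hlt
    · simp [h]
    · simp [Nat.sub_ne_zero_of_lt hlt]
  · set p : Polynomial L := ∑ i ∈ Finset.range (n + 1), Polynomial.monomial i (u i) with hp
    have hc : p.coeff n = u n := by
      simp [hp, Polynomial.coeff_monomial]
    have hd : p.degree ≠ 0 := by
      have h1 : (n : WithBot ℕ) ≤ p.degree := Polynomial.le_degree_of_ne_zero (by rwa [hc])
      intro h0
      rw [h0] at h1
      exact hn (by exact_mod_cast Nat.le_zero.1 (by exact_mod_cast h1))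
    obtain ⟨r, hr⟩ := IsAlgClosed.exists_root p hd
    refine ⟨1, r, by simp, ?_⟩
    simpa [hp, Polynomial.eval_finsetSum, Polynomial.IsRoot] using hr

theorem exists_quadratic_linear_zero {a b l q : L} (h : q ^ 2 + a * l * q + b * l ^ 2 = 0) :
    ∃ z, z ^ 2 - a * z + b = 0 ∧ l * z + q = 0 := by
  by_cases hl : l = 0
  · have hq : q = 0 := by simpa [hl] using h
    obtain ⟨z, hz⟩ := IsAlgClosed.exists_root
      (Polynomial.X ^ 2 - Polynomial.C a * Polynomial.X + Polynomial.C b) (by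
        have : (Polynomial.X ^ 2 - Polynomial.C a * Polynomial.X + Polynomial.C b).degree = 2 := by
          compute_degree!
        rw [this]
        decide)
    refine ⟨z, by simpa [Polynomial.IsRoot] using hz, by simp [hl, hq]⟩
  · refine ⟨-q / l, ?_, ?_⟩
    · field_simp
      linear_combination h
    · field_simp
      ring

/-- A smooth plane quartic is not a union of two conics. -/
theorem not_eval_eq_mul {F : MvPolynomial (Fin 3) L} (hF : F.IsHomogeneous 4)
    (hsm : ∀ P : Fin 3 → L, P ≠ 0 → ∃ i, eval P (pderiv i F) ≠ 0) {c : L} (hc : c ≠ 0)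
    {a₀ a₁ b₀ b₁ b₂ a₀' a₁' b₀' b₁' b₂' : L}
    (h : ∀ s z, c ^ 3 * eval ![1, s, z] F =
      ((c * z) ^ 2 - (a₀ + a₁ * s) * (c * z) + (b₀ + b₁ * s + b₂ * s ^ 2)) *
      ((c * z) ^ 2 - (a₀' + a₁' * s) * (c * z) + (b₀' + b₁' * s + b₂' * s ^ 2))) : False := by
  set M : MvPolynomial (Fin 3) L :=
    (C c * X 2) ^ 2 - (C a₀ * X 0 + C a₁ * X 1) * (C c * X 2) +
      (C b₀ * X 0 ^ 2 + C b₁ * X 0 * X 1 + C b₂ * X 1 ^ 2) with hM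
  set M' : MvPolynomial (Fin 3) L :=
    (C c * X 2) ^ 2 - (C a₀' * X 0 + C a₁' * X 1) * (C c * X 2) +
      (C b₀' * X 0 ^ 2 + C b₁' * X 0 * X 1 + C b₂' * X 1 ^ 2) with hM'
  have hFM : C (c ^ 3) * F = M * M' := by
    refine eq_of_eval_eq_of_ne_zero fun x y z hx => ?_
    rw [eval_mul, eval_C, eval_eq_of_isHomogeneous hF hx, mul_left_comm, h]
    simp only [hM, hM', eval_mul, eval_add, eval_sub, eval_pow, eval_C, eval_X,
      Matrix.cons_val_zero, Matrix.cons_val_one, Matrix.cons_val]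
    field_simp
  obtain ⟨x, y, hxy, hN⟩ := exists_binary_form_zero (L := L) (n := 4) (by norm_num)
    (fun i => ![(b₀' - b₀) ^ 2 + a₀ * (a₀ - a₀') * (b₀' - b₀) + b₀ * (a₀ - a₀') ^ 2,
      2 * (b₀' - b₀) * (b₁' - b₁) + a₀ * (a₀ - a₀') * (b₁' - b₁) +
        (a₀ * (a₁ - a₁') + a₁ * (a₀ - a₀')) * (b₀' - b₀) +
        2 * b₀ * (a₀ - a₀') * (a₁ - a₁') + b₁ * (a₀ - a₀') ^ 2,
      2 * (b₀' - b₀) * (b₂' - b₂) + (b₁' - b₁) ^ 2 + a₀ * (a₀ - a₀') * (b₂' - b₂) +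
        (a₀ * (a₁ - a₁') + a₁ * (a₀ - a₀')) * (b₁' - b₁) + a₁ * (a₁ - a₁') * (b₀' - b₀) +
        b₀ * (a₁ - a₁') ^ 2 + 2 * b₁ * (a₀ - a₀') * (a₁ - a₁') + b₂ * (a₀ - a₀') ^ 2,
      2 * (b₁' - b₁) * (b₂' - b₂) + (a₀ * (a₁ - a₁') + a₁ * (a₀ - a₀')) * (b₂' - b₂) +
        a₁ * (a₁ - a₁') * (b₁' - b₁) + b₁ * (a₁ - a₁') ^ 2 +
        2 * b₂ * (a₀ - a₀') * (a₁ - a₁'),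
      (b₂' - b₂) ^ 2 + a₁ * (a₁ - a₁') * (b₂' - b₂) + b₂ * (a₁ - a₁') ^ 2] (Fin.ofNat 5 i))
  obtain ⟨w, hw, hw'⟩ := exists_quadratic_linear_zero (a := a₀ * x + a₁ * y)
    (b := b₀ * x ^ 2 + b₁ * x * y + b₂ * y ^ 2) (l := (a₀ - a₀') * x + (a₁ - a₁') * y)
    (q := (b₀' - b₀) * x ^ 2 + (b₁' - b₁) * x * y + (b₂' - b₂) * y ^ 2) (by
      rw [← hN]
      simp [Finset.sum_range_succ, Fin.ofNat]
      ring)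
  have hcw : c * (w / c) = w := mul_div_cancel₀ _ hc
  have h1 : eval ![x, y, w / c] M = 0 := by
    simp [hM, hcw, ← hw]
  have h2 : eval ![x, y, w / c] M' = 0 := by
    simp only [hM', eval_mul, eval_add, eval_sub, eval_pow, eval_C, eval_X,
      Matrix.cons_val_zero, Matrix.cons_val_one, Matrix.cons_val, hcw]
    linear_combination hw + hw'
  obtain ⟨i, hi⟩ := hsm ![x, y, w / c] fun h0 => by
    have h3 := congrFun h0 0
    have h4 := congrFun h0 1
    simp at h3 h4
    exact hxy.elim (· h3) (· h4)
  have h5 := congrArg (fun F => eval ![x, y, w / c] (pderiv i F)) hFM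
  simp only [Derivation.leibniz, pderiv_C, smul_eq_mul, eval_add, eval_mul, h1, h2, eval_C] at h5
  simp [hc] at h5
  exact hi h5

/-- A smooth plane quartic does not have an equation of the form `Q ^ 2 = X Y ℓ ^ 2`. -/
theorem not_eval_eq_sq_sub {F : MvPolynomial (Fin 3) L} (hF : F.IsHomogeneous 4)
    (hsm : ∀ P : Fin 3 → L, P ≠ 0 → ∃ i, eval P (pderiv i F) ≠ 0) {c : L} (hc : c ≠ 0)
    {a₀ a₁ b₀ b₁ b₂ l q₀ q₁ : L}
    (h : ∀ s z, c ^ 3 * eval ![1, s, z] F =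
      ((c * z) ^ 2 - (a₀ + a₁ * s) * (c * z) + (b₀ + b₁ * s + b₂ * s ^ 2)) ^ 2 -
      s * (l * (c * z) + (q₀ + q₁ * s)) ^ 2) : False := by
  set M : MvPolynomial (Fin 3) L :=
    (C c * X 2) ^ 2 - (C a₀ * X 0 + C a₁ * X 1) * (C c * X 2) +
      (C b₀ * X 0 ^ 2 + C b₁ * X 0 * X 1 + C b₂ * X 1 ^ 2) with hM
  set M' : MvPolynomial (Fin 3) L :=
    C l * (C c * X 2) + (C q₀ * X 0 + C q₁ * X 1) with hM'
  have hFM : C (c ^ 3) * F = M * M - X 0 * X 1 * (M' * M') := by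
    refine eq_of_eval_eq_of_ne_zero fun x y z hx => ?_
    rw [eval_mul, eval_C, eval_eq_of_isHomogeneous hF hx, mul_left_comm, h]
    simp only [hM, hM', eval_mul, eval_add, eval_sub, eval_pow, eval_C, eval_X,
      Matrix.cons_val_zero, Matrix.cons_val_one, Matrix.cons_val]
    field_simp
  obtain ⟨x, y, hxy, hN⟩ := exists_binary_form_zero (L := L) (n := 2) (by norm_num)
    (fun i => ![q₀ ^ 2 + a₀ * l * q₀ + b₀ * l ^ 2,
      2 * q₀ * q₁ + (a₀ * q₁ + a₁ * q₀) * l + b₁ * l ^ 2,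
      q₁ ^ 2 + a₁ * l * q₁ + b₂ * l ^ 2] (Fin.ofNat 3 i))
  obtain ⟨w, hw, hw'⟩ := exists_quadratic_linear_zero (a := a₀ * x + a₁ * y)
    (b := b₀ * x ^ 2 + b₁ * x * y + b₂ * y ^ 2) (l := l)
    (q := q₀ * x + q₁ * y) (by
      rw [← hN]
      simp [Finset.sum_range_succ, Fin.ofNat]
      ring)
  have hcw : c * (w / c) = w := mul_div_cancel₀ _ hc
  have h1 : eval ![x, y, w / c] M = 0 := by
    simp [hM, hcw, ← hw]
  have h2 : eval ![x, y, w / c] M' = 0 := by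
    simp [hM', hcw, ← hw']
  obtain ⟨i, hi⟩ := hsm ![x, y, w / c] fun h0 => by
    have h3 := congrFun h0 0
    have h4 := congrFun h0 1
    simp at h3 h4
    exact hxy.elim (· h3) (· h4)
  have h5 := congrArg (fun F => eval ![x, y, w / c] (pderiv i F)) hFM
  simp only [map_sub, Derivation.leibniz, pderiv_C, smul_eq_mul, eval_add, eval_mul, h1, h2,
    eval_C] at h5
  simp [hc] at h5
  exact hi h5

end PlaneQuartic

section QuadraticFactors

section Domain

variable {R : Type*} [CommRing R]

theorem Polynomial.Monic.eq_quadratic {G : Polynomial R} (hG : G.Monic) (h2 : G.natDegree = 2) :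
    G = Polynomial.X ^ 2 + Polynomial.C (G.coeff 1) * Polynomial.X + Polynomial.C (G.coeff 0) := by
  conv_lhs => rw [hG.as_sum, h2]
  simp [Finset.sum_range_succ]
  ring

variable [IsDomain R]

theorem natDegree_le_of_quadratic_factors {a b a' b' : Polynomial R} {n : ℕ}
    (h1 : (a + a').natDegree ≤ n) (h2 : (b + b' + a * a').natDegree ≤ 2 * n)
    (h3 : (a * b' + a' * b).natDegree ≤ 3 * n) (h4 : (b * b').natDegree ≤ 4 * n) :
    a.natDegree ≤ n ∧ b.natDegree ≤ 2 * n := by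
  have key : ∀ p q : Polynomial R, ∀ N, (p + q).natDegree ≤ N → N < p.natDegree →
      q.natDegree = p.natDegree := by
    intro p q N h hN
    have : q = (p + q) - p := by ring
    rw [this]
    exact Polynomial.natDegree_sub_eq_right_of_natDegree_lt (by omega)
  have aux : ∀ a a' b b' : Polynomial R, (a * b' + a' * b).natDegree ≤ 3 * n →
      (b * b').natDegree ≤ 4 * n → n < a.natDegree → a'.natDegree = a.natDegree →
      a.natDegree + a.natDegree ≤ b.natDegree → False := by
    intro a a' b b' h3 h4 ha haa hb
    have ha'0 : a' ≠ 0 := Polynomial.ne_zero_of_natDegree_gt (n := n) (by omega)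
    have hb0 : b ≠ 0 := Polynomial.ne_zero_of_natDegree_gt (n := n) (by omega)
    have h5 : (a' * b).natDegree = a'.natDegree + b.natDegree :=
      Polynomial.natDegree_mul ha'0 hb0
    have h6 := key (a' * b) (a * b') (3 * n) (by rwa [add_comm]) (by omega)
    by_cases hb' : b' = 0
    · simp only [hb', mul_zero, Polynomial.natDegree_zero] at h6
      omega
    · rw [Polynomial.natDegree_mul hb0 hb'] at h4
      have := Polynomial.natDegree_mul_le (p := a) (q := b')
      omega
  have ha : a.natDegree ≤ n := by
    by_contra! ha
    have haa := key a a' n h1 ha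
    have hm : (a * a').natDegree = a.natDegree + a'.natDegree :=
      Polynomial.natDegree_mul (Polynomial.ne_zero_of_natDegree_gt (n := n) (by omega))
        (Polynomial.ne_zero_of_natDegree_gt (n := n) (by omega))
    have h5 := key (a * a') (b + b') (2 * n) (by rwa [add_comm]) (by omega)
    rcases le_or_gt (a.natDegree + a.natDegree) b.natDegree with hb | hb
    · exact aux a a' b b' h3 h4 ha haa hb
    · refine aux a' a b' b (by rwa [add_comm]) (by rwa [mul_comm]) (by omega) haa.symm ?_
      have := Polynomial.natDegree_add_le b b'
      have := le_max_iff.1 this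
      omega
  refine ⟨ha, ?_⟩
  by_contra! hb
  have ha' : a'.natDegree ≤ n := by
    by_contra! ha'
    have := key a' a n (by rwa [add_comm]) ha'
    omega
  have h5 : (b + b').natDegree ≤ 2 * n := by
    have h6 : b + b' = (b + b' + a * a') - a * a' := by ring
    rw [h6]
    refine (Polynomial.natDegree_sub_le _ _).trans (max_le h2 ?_)
    exact Polynomial.natDegree_mul_le.trans (by omega)
  have h6 := key b b' _ h5 hb
  rw [Polynomial.natDegree_mul (Polynomial.ne_zero_of_natDegree_gt hb)
    (Polynomial.ne_zero_of_natDegree_gt (n := 2 * n) (by omega))] at h4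
  omega

theorem map_eq_or_eq_of_quadratic_factors [UniqueFactorizationMonoid R] {G H : Polynomial R}
    (hG : G.Monic) (hH : H.Monic) (hG2 : G.natDegree = 2) (hH2 : H.natDegree = 2) {θ : R →+* R}
    (hθ : (G * H).map θ = G * H) (hroot : ∀ r, (G * H).eval r ≠ 0) :
    (G.map θ = G ∧ H.map θ = H) ∨ (G.map θ = H ∧ H.map θ = G) := by
  have hm := hG.map θ
  have hm2 : (G.map θ).natDegree = 2 := by rw [hG.natDegree_map, hG2]
  rw [Polynomial.map_mul] at hθ
  have hirr : Irreducible (G.map θ) := by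
    rw [hm.irreducible_iff_roots_eq_zero_of_degree_le_three (by omega) (by omega)]
    refine Multiset.eq_zero_of_forall_notMem fun r hr => hroot r ?_
    rw [← hθ, Polynomial.eval_mul, (Polynomial.mem_roots'.1 hr).2.eq_zero, zero_mul]
  have hdvd : G.map θ ∣ G * H := ⟨_, hθ.symm⟩
  rcases hirr.prime.dvd_or_dvd hdvd with h | h
  · left
    have h1 := Polynomial.eq_of_monic_of_dvd_of_natDegree_le hm hG h (by omega)
    refine ⟨h1.symm, mul_left_cancel₀ hG.ne_zero ?_⟩
    rwa [← h1] at hθ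
  · right
    have h1 := Polynomial.eq_of_monic_of_dvd_of_natDegree_le hm hH h (by omega)
    refine ⟨h1.symm, mul_left_cancel₀ hH.ne_zero ?_⟩
    rw [← h1] at hθ
    rw [hθ, mul_comm]

end Domain

variable {L : Type*} [Field L]

theorem exists_expand_eq_of_comp_eq {ω : L} {e : ℕ} (he : 0 < e) (hω : IsPrimitiveRoot ω e)
    {p : Polynomial L} (hp : p.comp (Polynomial.C ω * Polynomial.X) = p) :
    ∃ q, Polynomial.expand L e q = p := by
  refine ⟨p.contract e, ?_⟩
  ext n
  rw [Polynomial.coeff_expand he]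
  split_ifs with h
  · rw [Polynomial.coeff_contract he.ne', Nat.div_mul_cancel h]
  · by_contra h0
    have h1 := congrArg (fun p => p.coeff n) hp
    simp only [Polynomial.comp_C_mul_X_coeff] at h1
    exact h ((hω.pow_eq_one_iff_dvd n).1 (mul_left_cancel₀ (Ne.symm h0) (by rw [h1, mul_one])))

theorem exists_map_expand_eq_of_map_comp_eq {ω : L} {e : ℕ} (he : 0 < e)
    (hω : IsPrimitiveRoot ω e) {G : Polynomial (Polynomial L)}
    (hG : G.map (Polynomial.compRingHom (Polynomial.C ω * Polynomial.X)) = G) :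
    ∃ Q : Polynomial (Polynomial L), Q.map (Polynomial.expand L e).toRingHom = G := by
  change G ∈ Set.range (Polynomial.map (Polynomial.expand L e).toRingHom)
  rw [← Polynomial.coe_mapRingHom, ← RingHom.coe_range, SetLike.mem_coe, Polynomial.mem_map_range]
  intro n
  obtain ⟨q, hq⟩ := exists_expand_eq_of_comp_eq he hω (p := G.coeff n) (by
    conv_rhs => rw [← hG]
    rw [Polynomial.coeff_map]
    rfl)
  exact ⟨q, hq⟩

end QuadraticFactors

section FunctionField

variable {L : Type*} [Field L]

theorem exists_quadratic_factorization {f : Polynomial (Polynomial L)} (hf : f.Monic)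
    (h3 : 3 ≤ f.natDegree) (h4 : f.natDegree ≤ 4) {e : ℕ}
    (hroot : ∀ g, (f.map (Polynomial.expand L e).toRingHom).eval g ≠ 0) {φ : PowerSeries L}
    (hφ : (f.map (expandPowerSeries L e)).eval φ = 0) {A B : Polynomial L}
    (hAB : φ ^ 2 - A * φ + B = 0) :
    f.natDegree = 4 ∧ ∃ G H : Polynomial (Polynomial L), G.Monic ∧ H.Monic ∧ G.natDegree = 2 ∧
      H.natDegree = 2 ∧ G * H = f.map (Polynomial.expand L e).toRingHom := by
  set fe := f.map (Polynomial.expand L e).toRingHom with hfe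
  have hfem : fe.Monic := hf.map _
  have hfed : fe.natDegree = f.natDegree := hf.natDegree_map _
  have halg : algebraMap (Polynomial L) (PowerSeries L) =
      Polynomial.coeToPowerSeries.ringHom := by
    exact RingHom.ext fun p => rfl
  have hinj : Function.Injective (algebraMap (Polynomial L) (PowerSeries L)) :=
    Polynomial.coe_injective L
  have : Module.IsTorsionFree (Polynomial L) (PowerSeries L) :=
    Module.isTorsionFree_iff_algebraMap_injective.2 hinj
  have h1 : Polynomial.aeval φ fe = 0 := by
    rw [Polynomial.aeval_def, halg, hfe, Polynomial.eval₂_map, ← Polynomial.eval_map]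
    exact hφ
  have h_int : IsIntegral (Polynomial L) φ := ⟨fe, hfem, h1⟩
  set q : Polynomial (Polynomial L) :=
    Polynomial.X ^ 2 - Polynomial.C A * Polynomial.X + Polynomial.C B with hq
  have hqd : q.natDegree = 2 := by
    rw [hq]
    compute_degree!
  have h2 : Polynomial.aeval φ q = 0 := by
    simpa [hq, halg] using hAB
  set G := minpoly (Polynomial L) φ
  have hGm : G.Monic := minpoly.monic h_int
  obtain ⟨H, hH⟩ := minpoly.isIntegrallyClosed_dvd h_int h1
  have hlin : ∀ p p' : Polynomial (Polynomial L), p.Monic → fe = p * p' → p.natDegree ≠ 1 := by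
    intro p p' hp hpp h
    apply hroot (-p.coeff 0)
    rw [hpp, Polynomial.eval_mul, hp.eq_X_add_C h]
    simp
  have hGd : G.natDegree ≤ 2 := by
    rw [← hqd]
    exact Polynomial.natDegree_le_of_dvd (minpoly.isIntegrallyClosed_dvd h_int h2)
      (Polynomial.ne_zero_of_natDegree_gt (n := 1) (by omega))
  have hG0 : 0 < G.natDegree := minpoly.natDegree_pos h_int
  have hG1 : G.natDegree ≠ 1 := hlin G H hGm hH
  have hHm : H.Monic := hGm.of_mul_monic_left (hH ▸ hfem)
  have hH1 : H.natDegree ≠ 1 := hlin H G hHm (by rw [hH, mul_comm])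
  have hsum : fe.natDegree = G.natDegree + H.natDegree := by
    rw [hH, hGm.natDegree_mul hHm]
  exact ⟨by omega, G, H, hGm, hHm, by omega, by omega, hH.symm⟩

theorem exists_quadratic_factorization_expand_two [IsAlgClosed L] [CharZero L]
    {f : Polynomial (Polynomial L)} {e : ℕ} (he : 0 < e)
    (hroot : ∀ g, (f.map (Polynomial.expand L (2 * e)).toRingHom).eval g ≠ 0)
    {G H : Polynomial (Polynomial L)} (hG : G.Monic) (hH : H.Monic) (hG2 : G.natDegree = 2)
    (hH2 : H.natDegree = 2) (hGH : G * H = f.map (Polynomial.expand L e).toRingHom) :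
    ∃ Q Q' : Polynomial (Polynomial L), Q.Monic ∧ Q'.Monic ∧ Q.natDegree = 2 ∧
      Q'.natDegree = 2 ∧ Q * Q' = f.map (Polynomial.expand L 2).toRingHom := by
  have : NeZero (2 * e) := ⟨by omega⟩
  obtain ⟨ω, hω⟩ := HasEnoughRootsOfUnity.exists_primitiveRoot L (2 * e)
  have hcomp : ∀ a b, (Polynomial.expand L (a * b)).toRingHom =
      (Polynomial.expand L a).toRingHom.comp (Polynomial.expand L b).toRingHom := by
    intro a b
    exact RingHom.ext fun p => Polynomial.expand_mul a b p
  set G₁ := G.map (Polynomial.expand L 2).toRingHom with hG₁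
  set H₁ := H.map (Polynomial.expand L 2).toRingHom with hH₁
  have hGH₁ : G₁ * H₁ = f.map (Polynomial.expand L (2 * e)).toRingHom := by
    rw [hG₁, hH₁, ← Polynomial.map_mul, hGH, Polynomial.map_map, hcomp]
  have hscale : ∀ p : Polynomial (Polynomial L), ∀ θ : L,
      (p.map (Polynomial.compRingHom (Polynomial.C θ * Polynomial.X))).map
        (Polynomial.compRingHom (Polynomial.C θ * Polynomial.X)) =
      p.map (Polynomial.compRingHom (Polynomial.C (θ ^ 2) * Polynomial.X)) := by
    intro p θ
    rw [Polynomial.map_map]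
    refine congrArg (fun g => p.map g) (Polynomial.ringHom_ext (by simp) ?_)
    simp [← mul_assoc, sq]
  have hθ : (G₁ * H₁).map (Polynomial.compRingHom (Polynomial.C ω * Polynomial.X)) = G₁ * H₁ := by
    rw [hGH₁, Polynomial.map_map]
    refine congrArg (fun g => f.map g) (Polynomial.ringHom_ext (by simp) ?_)
    simp [mul_pow, ← Polynomial.C_pow, hω.pow_eq_one]
  have hfix : G₁.map (Polynomial.compRingHom (Polynomial.C (ω ^ 2) * Polynomial.X)) = G₁ ∧
      H₁.map (Polynomial.compRingHom (Polynomial.C (ω ^ 2) * Polynomial.X)) = H₁ := by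
    rw [← hscale, ← hscale]
    rcases map_eq_or_eq_of_quadratic_factors (hG.map _) (hH.map _)
      (by rw [hG.natDegree_map, hG2]) (by rw [hH.natDegree_map, hH2]) hθ
      (by rw [hGH₁]; exact hroot) with h | h
    · rwa [h.1, h.2]
    · rw [h.1, h.2]
      exact ⟨rfl, h.1⟩
  have hω2 : IsPrimitiveRoot (ω ^ 2) e := hω.pow (by omega) rfl
  obtain ⟨Q, hQ⟩ := exists_map_expand_eq_of_map_comp_eq he hω2 hfix.1
  obtain ⟨Q', hQ'⟩ := exists_map_expand_eq_of_map_comp_eq he hω2 hfix.2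
  have hinj : Function.Injective (Polynomial.expand L e).toRingHom :=
    Polynomial.expand_injective he
  refine ⟨Q, Q', Polynomial.monic_of_injective hinj (hQ ▸ hG.map _),
    Polynomial.monic_of_injective hinj (hQ' ▸ hH.map _), ?_, ?_, ?_⟩
  · rw [← Polynomial.natDegree_map_eq_of_injective hinj, hQ, hG.natDegree_map, hG2]
  · rw [← Polynomial.natDegree_map_eq_of_injective hinj, hQ', hH.natDegree_map, hH2]
  · refine Polynomial.map_injective _ hinj ?_
    rw [Polynomial.map_mul, hQ, hQ', hGH₁, Polynomial.map_map, ← hcomp, mul_comm]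

theorem natDegree_coeff_le_of_quadratic_factors {Q Q' : Polynomial (Polynomial L)}
    (hQ : Q.Monic) (hQ' : Q'.Monic) (hQ2 : Q.natDegree = 2) (hQ2' : Q'.natDegree = 2)
    (h : ∀ i < 4, ((Q * Q').coeff i).natDegree ≤ 2 * (4 - i)) :
    (Q.coeff 1).natDegree ≤ 2 ∧ (Q.coeff 0).natDegree ≤ 4 := by
  have hQe := hQ.eq_quadratic hQ2
  have hQe' := hQ'.eq_quadratic hQ2'
  set a := Q.coeff 1
  set b := Q.coeff 0
  set a' := Q'.coeff 1
  set b' := Q'.coeff 0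
  have hmul : Q * Q' = Polynomial.X ^ 4 + Polynomial.C (a + a') * Polynomial.X ^ 3 +
      Polynomial.C (b + b' + a * a') * Polynomial.X ^ 2 +
      Polynomial.C (a * b' + a' * b) * Polynomial.X + Polynomial.C (b * b') := by
    rw [hQe, hQe']
    simp only [Polynomial.C_add, Polynomial.C_mul]
    ring
  have hcoeff : ∀ c₃ c₂ c₁ c₀ : Polynomial L, ∀ p, p = Polynomial.X ^ 4 +
      Polynomial.C c₃ * Polynomial.X ^ 3 + Polynomial.C c₂ * Polynomial.X ^ 2 +
      Polynomial.C c₁ * Polynomial.X + Polynomial.C c₀ →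
      p.coeff 3 = c₃ ∧ p.coeff 2 = c₂ ∧ p.coeff 1 = c₁ ∧ p.coeff 0 = c₀ := by
    rintro c₃ c₂ c₁ c₀ p rfl
    simp [Polynomial.coeff_X, Polynomial.coeff_C]
  obtain ⟨h3, h2, h1, h0⟩ := hcoeff _ _ _ _ _ hmul
  exact natDegree_le_of_quadratic_factors (n := 2) (h3 ▸ h 3 (by norm_num))
    (h2 ▸ h 2 (by norm_num)) (h1 ▸ h 1 (by norm_num)) (h0 ▸ h 0 (by norm_num))

end FunctionField

section FunctionFieldContradiction

variable {L : Type*} [Field L]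

theorem eval_eq_of_natDegree_le_one {p : Polynomial L} (h : p.natDegree ≤ 1) (s : L) :
    p.eval s = p.coeff 0 + p.coeff 1 * s := by
  rw [Polynomial.eval_eq_sum_range' (n := 2) (by omega)]
  simp [Finset.sum_range_succ]

theorem eval_eq_of_natDegree_le_two {p : Polynomial L} (h : p.natDegree ≤ 2) (s : L) :
    p.eval s = p.coeff 0 + p.coeff 1 * s + p.coeff 2 * s ^ 2 := by
  rw [Polynomial.eval_eq_sum_range' (n := 3) (by omega)]
  simp [Finset.sum_range_succ]

theorem evalEval_quadratic {Q : Polynomial (Polynomial L)} (hQ : Q.Monic) (h2 : Q.natDegree = 2)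
    (s z : L) : Q.evalEval s z = z ^ 2 + (Q.coeff 1).eval s * z + (Q.coeff 0).eval s := by
  conv_lhs => rw [hQ.eq_quadratic h2]
  simp [Polynomial.evalEval]

variable [IsAlgClosed L] [CharZero L]

/-- A Puiseux expansion of the dehomogenization of a smooth plane quartic is not quadratic over
the ring of polynomials in a root of the coordinate. -/
theorem quadratic_puiseux_root_ne_zero {F : MvPolynomial (Fin 3) L} (hF : F.IsHomogeneous 4)
    (hsm : ∀ P : Fin 3 → L, P ≠ 0 → ∃ i, eval P (pderiv i F) ≠ 0) {e : ℕ} (he : 0 < e)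
    {φ : PowerSeries L}
    (hφ : ((affinePart F).integralNormalization.map (expandPowerSeries L e)).eval φ = 0)
    (A B : Polynomial L) : φ ^ 2 - A * φ + B ≠ 0 := by
  intro hAB
  have h3 := three_le_natDegree_affinePart hF (hsm _ fun h => by simpa using congrFun h 2)
  have h4 := natDegree_affinePart_le hF
  have hci := natDegree_coeff_affinePart_le hF
  have hev := affinePart_evalEval F
  have hroot : ∀ e : ℕ, 0 < e → ∀ g, ((affinePart F).integralNormalization.map
      (Polynomial.expand L e).toRingHom).eval g ≠ 0 := by
    intro e he g
    rw [Polynomial.eval_map]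
    exact affinePart_integralNormalization_eval₂_ne_zero hF hsm he g
  set h := affinePart F
  have h0 : h ≠ 0 := Polynomial.ne_zero_of_natDegree_gt h3
  have hfd : h.integralNormalization.natDegree = h.natDegree :=
    Polynomial.natDegree_integralNormalization
  have hf : h.integralNormalization.Monic := Polynomial.monic_integralNormalization h0
  obtain ⟨hd, G, H, hG, hH, hG2, hH2, hGH⟩ := exists_quadratic_factorization hf (by omega)
    (by omega) (hroot e he) hφ hAB
  obtain ⟨Q, Q', hQ, hQ', hQ2, hQ2', hQQ⟩ := exists_quadratic_factorization_expand_two he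
    (hroot (2 * e) (by omega)) hG hH hG2 hH2 hGH
  rw [hfd] at hd
  obtain ⟨c, hc⟩ : ∃ c, h.leadingCoeff = Polynomial.C c := by
    have := hci 4
    refine ⟨_, Polynomial.eq_C_of_natDegree_le_zero ?_⟩
    rwa [Polynomial.leadingCoeff, hd]
  have hc0 : c ≠ 0 := by
    rintro rfl
    rw [Polynomial.C_0, Polynomial.leadingCoeff_eq_zero] at hc
    exact h0 hc
  have hval : ∀ τ z, c ^ 3 * eval ![1, τ ^ 2, z] F =
      Q.evalEval τ (c * z) * Q'.evalEval τ (c * z) := by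
    intro τ z
    have h1 := Polynomial.integralNormalization_eval₂_leadingCoeff_mul (p := h) (by omega)
      (Polynomial.evalRingHom (τ ^ 2)) z
    rw [Polynomial.eval₂_evalRingHom, hc, Polynomial.coe_evalRingHom, Polynomial.eval_C, hd] at h1
    rw [← Polynomial.evalEval_mul, hQQ, expand_evalEval, h1]
    rw [← hev]
  have hcoeff : ∀ i < 4, ((Q * Q').coeff i).natDegree ≤ 2 * (4 - i) := by
    intro i hi
    rw [hQQ, Polynomial.coeff_map]
    change (Polynomial.expand L 2 _).natDegree ≤ _
    rw [Polynomial.natDegree_expand, mul_comm]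
    refine Nat.mul_le_mul_left _ ?_
    rw [Polynomial.integralNormalization_coeff_ne_natDegree (by omega), hc, ← Polynomial.C_pow]
    exact (Polynomial.natDegree_mul_C_le _ _).trans (hci i)
  have hdeg := natDegree_coeff_le_of_quadratic_factors hQ hQ' hQ2 hQ2' hcoeff
  have hdeg' := natDegree_coeff_le_of_quadratic_factors hQ' hQ hQ2' hQ2
    (by rwa [mul_comm])
  have hω : IsPrimitiveRoot (-1 : L) 2 := IsPrimitiveRoot.neg_one 0 (by norm_num)
  have hθ : (Q * Q').map (Polynomial.compRingHom (Polynomial.C (-1) * Polynomial.X)) =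
      Q * Q' := by
    rw [hQQ, Polynomial.map_map]
    refine congrArg (fun g => Polynomial.map g _) (Polynomial.ringHom_ext (by simp) ?_)
    simp
  have hsq : ∀ s : L, ∃ τ, τ ^ 2 = s := fun s => IsAlgClosed.exists_pow_nat_eq s (by norm_num)
  rcases map_eq_or_eq_of_quadratic_factors hQ hQ' hQ2 hQ2' hθ
    (by rw [hQQ]; exact hroot 2 (by norm_num)) with hT | hT
  · obtain ⟨q, rfl⟩ := exists_map_expand_eq_of_map_comp_eq (by norm_num) hω hT.1
    obtain ⟨q', rfl⟩ := exists_map_expand_eq_of_map_comp_eq (by norm_num) hω hT.2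
    have hinj : Function.Injective (Polynomial.expand L 2).toRingHom :=
      Polynomial.expand_injective (by norm_num)
    have hexp : ∀ p : Polynomial L, ((Polynomial.expand L 2).toRingHom p).natDegree =
      p.natDegree * 2 := fun p => Polynomial.natDegree_expand 2 p
    rw [Polynomial.natDegree_map_eq_of_injective hinj] at hQ2 hQ2'
    simp only [Polynomial.coeff_map, hexp] at hdeg hdeg'
    have hq := Polynomial.monic_of_injective hinj hQ
    have hq' := Polynomial.monic_of_injective hinj hQ'
    refine not_eval_eq_mul hF hsm hc0 (a₀ := -(q.coeff 1).coeff 0) (a₁ := -(q.coeff 1).coeff 1)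
      (b₀ := (q.coeff 0).coeff 0) (b₁ := (q.coeff 0).coeff 1) (b₂ := (q.coeff 0).coeff 2)
      (a₀' := -(q'.coeff 1).coeff 0) (a₁' := -(q'.coeff 1).coeff 1)
      (b₀' := (q'.coeff 0).coeff 0) (b₁' := (q'.coeff 0).coeff 1) (b₂' := (q'.coeff 0).coeff 2)
      fun s z => ?_
    obtain ⟨τ, rfl⟩ := hsq s
    rw [hval, expand_evalEval, expand_evalEval, evalEval_quadratic hq hQ2,
      evalEval_quadratic hq' hQ2', eval_eq_of_natDegree_le_one (p := q.coeff 1) (by omega),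
      eval_eq_of_natDegree_le_one (p := q'.coeff 1) (by omega),
      eval_eq_of_natDegree_le_two (p := q.coeff 0) (by omega),
      eval_eq_of_natDegree_le_two (p := q'.coeff 0) (by omega)]
    ring
  · have h1 := congrArg (fun p => p.coeff 1) hT.1
    have h2 := congrArg (fun p => p.coeff 0) hT.1
    simp only [Polynomial.coeff_map, Polynomial.coe_compRingHom] at h1 h2
    refine not_eval_eq_sq_sub hF hsm hc0 (a₀ := -(Q.coeff 1).coeff 0) (a₁ := -(Q.coeff 1).coeff 2)
      (b₀ := (Q.coeff 0).coeff 0) (b₁ := (Q.coeff 0).coeff 2) (b₂ := (Q.coeff 0).coeff 4)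
      (l := (Q.coeff 1).coeff 1) (q₀ := (Q.coeff 0).coeff 1) (q₁ := (Q.coeff 0).coeff 3)
      fun s z => ?_
    obtain ⟨τ, rfl⟩ := hsq s
    rw [hval, evalEval_quadratic hQ hQ2, evalEval_quadratic hQ' hQ2', ← h1, ← h2,
      Polynomial.eval_comp, Polynomial.eval_comp,
      Polynomial.eval_eq_sum_range' (p := Q.coeff 1) (n := 3) (by omega),
      Polynomial.eval_eq_sum_range' (p := Q.coeff 1) (n := 3) (by omega),
      Polynomial.eval_eq_sum_range' (p := Q.coeff 0) (n := 5) (by omega),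
      Polynomial.eval_eq_sum_range' (p := Q.coeff 0) (n := 5) (by omega)]
    simp only [Finset.sum_range_succ, Finset.sum_range_zero, Polynomial.eval_mul,
      Polynomial.eval_C, Polynomial.eval_X]
    ring

end FunctionFieldContradiction

section Arithmetic

theorem exists_sizeLE_of_evalEval_eq_zero {L : Type*} [Field L] [CharZero L]
    [Algebra.IsAlgebraic ℚ L] {f : Polynomial (Polynomial L)} (hf : f.Monic) (s r : L) :
    ∃ C D : ℕ, ∀ (m : ℕ) (w : L), f.evalEval (s * r ^ m) w = 0 → SizeLE (C * D ^ m) w := by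
  choose E hE using exists_coeff_sizeLE (L := L)
  set N := ∏ i ∈ Finset.range (f.natDegree + 1), E (f.coeff i) with hN
  have hNpos : 0 < N := Finset.prod_pos fun i _ => (hE _ 0).1
  have hcoeff : ∀ i j, SizeLE N ((f.coeff i).coeff j) := by
    intro i j
    by_cases hi : i < f.natDegree + 1
    · exact (hE _ _).mono_dvd
        (Finset.dvd_prod_of_mem (fun i => E (f.coeff i)) (Finset.mem_range.2 hi)) hNpos
    · rw [Polynomial.coeff_eq_zero_of_natDegree_lt (p := f) (by omega)]
      exact ⟨hNpos, by simpa using isIntegral_zero, by simp⟩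
  set n := (Finset.range (f.natDegree + 1)).sup fun i => (f.coeff i).natDegree with hn
  have hdeg : ∀ i, (f.coeff i).natDegree ≤ n := by
    intro i
    by_cases hi : i < f.natDegree + 1
    · exact Finset.le_sup (f := fun i => (f.coeff i).natDegree) (Finset.mem_range.2 hi)
    · rw [Polynomial.coeff_eq_zero_of_natDegree_lt (p := f) (by omega)]
      simp
  obtain ⟨A, hA⟩ := SizeLE.exists_of_isAlgebraic s
  obtain ⟨B, hB⟩ := SizeLE.exists_of_isAlgebraic r
  refine ⟨(n + 1) * (N * A ^ n) * (f.natDegree + 1), B ^ n, fun m w hw => ?_⟩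
  rw [← Polynomial.map_evalRingHom_eval] at hw
  have h := SizeLE.of_isRoot (hf.map _) (E := (n + 1) * (N * (A * B ^ m) ^ n)) (fun i => by
    rw [Polynomial.coeff_map, Polynomial.coe_evalRingHom]
    exact SizeLE.eval (hdeg i) (hcoeff i) (hA.mul (hB.pow m))) hw
  rw [hf.natDegree_map] at h
  convert h using 1
  ring

theorem exists_conjugate_of_natDegree_minpoly_le_two {k L : Type*} [Field k] [Field L]
    [Algebra k L] {w : L} (h_int : IsIntegral k w) (hw : (minpoly k w).natDegree ≤ 2) :
    ∃ w' : L, ∃ a b : k, w + w' = algebraMap k L a ∧ w * w' = algebraMap k L b ∧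
      ∀ p : Polynomial k, Polynomial.aeval w p = 0 → Polynomial.aeval w' p = 0 := by
  rcases hw.lt_or_eq with h | h
  · have h1 : (minpoly k w).natDegree = 1 := by
      have := minpoly.natDegree_pos h_int
      omega
    obtain ⟨c, rfl⟩ := minpoly.natDegree_eq_one_iff.1 h1
    exact ⟨algebraMap k L c, c + c, c * c, by simp, by simp, fun p hp => hp⟩
  · have h1 := (minpoly.monic h_int).eq_quadratic h
    set c₁ := (minpoly k w).coeff 1
    set c₀ := (minpoly k w).coeff 0
    have h2 := minpoly.aeval k w
    rw [h1] at h2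
    simp at h2
    refine ⟨-algebraMap k L c₁ - w, -c₁, c₀, ?_, ?_, fun p hp => ?_⟩
    · simp
    · linear_combination -h2
    · obtain ⟨r, rfl⟩ := minpoly.dvd k w hp
      rw [map_mul, h1]
      simp only [map_add, map_mul, map_pow, Polynomial.aeval_X, Polynomial.aeval_C]
      linear_combination (Polynomial.aeval (-algebraMap k L c₁ - w) r) * h2

theorem natDegree_minpoly_le_of_mem {k L : Type*} [Field k] [Field L] [Algebra k L]
    {K : IntermediateField k L} [FiniteDimensional k K] {w : L} (hw : w ∈ K) :
    (minpoly k w).natDegree ≤ Module.finrank k K := by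
  have h := IntermediateField.minpoly_eq (⟨w, hw⟩ : K)
  rw [← h]
  exact minpoly.natDegree_le _

variable {k L : Type*} [Field k] [NumberField k] [Field L] [CharZero L] [IsAlgClosed L]
  [Algebra k L] [Algebra.IsAlgebraic k L]

theorem not_forall_quadratic_over_convergent_progression {F : MvPolynomial (Fin 3) k}
    (hF : F.IsHomogeneous 4)
    (hsm : ∀ P : Fin 3 → L, P ≠ 0 → ∃ i, eval P (pderiv i (map (algebraMap k L) F)) ≠ 0)
    {ν : AbsoluteValue L ℝ} (hν : IsLiouvilleAbs k ν) {s q : k} (hs0 : s ≠ 0) (hq0 : q ≠ 0)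
    (hq : ν (algebraMap k L q) < 1) {ζ : ℕ → L}
    (hζ : ∀ n, eval ![1, algebraMap k L (s * q ^ n), ζ n] (map (algebraMap k L) F) = 0)
    (hK : ∀ n, ∃ K : IntermediateField k L,
      FiniteDimensional k K ∧ Module.finrank k K ≤ 2 ∧ ζ n ∈ K) : False := by
  have : Algebra.IsAlgebraic ℚ L := Algebra.IsAlgebraic.trans ℚ k L
  have hF' : (map (algebraMap k L) F).IsHomogeneous 4 := hF.map _
  have h3 := three_le_natDegree_affinePart hF' (hsm _ fun h => by simpa using congrFun h 2)
  have h4 := natDegree_affinePart_le hF'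
  have hroot := fun e he φ hφ => quadratic_puiseux_root_ne_zero hF' hsm (e := e) he (φ := φ) hφ
  have hζ' : ∀ n, (affinePart (map (algebraMap k L) F)).evalEval (algebraMap k L (s * q ^ n))
      (ζ n) = 0 := fun n => by rw [affinePart_evalEval, hζ]
  rw [affinePart_map] at h3 h4 hroot hζ'
  set ι := Polynomial.mapRingHom (algebraMap k L) with hι
  have hιinj : Function.Injective ι := Polynomial.map_injective _ (algebraMap k L).injective
  set h := affinePart F
  have h0 : h ≠ 0 := by
    rintro h0
    simp [h0] at h3
  rw [Polynomial.natDegree_map_eq_of_injective hιinj] at h3 h4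
  have hfm : (h.map ι).integralNormalization = h.integralNormalization.map ι :=
    Polynomial.integralNormalization_map _ _ (by
      rw [map_ne_zero_iff _ hιinj]
      exact Polynomial.leadingCoeff_ne_zero.2 h0)
  rw [hfm] at hroot
  set f := h.integralNormalization with hf
  have hfmon : (f.map ι).Monic := (Polynomial.monic_integralNormalization h0).map _
  have hfdeg : (f.map ι).natDegree ≤ 4 := by
    rwa [Polynomial.natDegree_map_eq_of_injective hιinj, hf,
      Polynomial.natDegree_integralNormalization]
  obtain ⟨e, he, Φ, hΦ⟩ := exists_puiseux_factorization hfmon hfdeg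
  obtain ⟨κ, hκ⟩ := IsAlgClosed.exists_pow_nat_eq (algebraMap k L s) he
  have hκ0 : κ ≠ 0 := by
    rintro rfl
    rw [zero_pow he.ne'] at hκ
    exact hs0 ((map_eq_zero _).1 hκ.symm)
  have hev : ∀ (c : k) (w : L), (f.map ι).evalEval (algebraMap k L c) w =
      Polynomial.aeval w (f.map (Polynomial.evalRingHom c)) := by
    intro c w
    rw [← Polynomial.eval₂_evalRingHom, Polynomial.eval₂_map, Polynomial.aeval_def,
      Polynomial.eval₂_map]
    refine congrArg (fun g => Polynomial.eval₂ g w f) (Polynomial.ringHom_ext (fun a => ?_) ?_)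
    · simp [hι]
    · simp [hι]
  have hpow : ∀ m, (κ * algebraMap k L q ^ m) ^ e = algebraMap k L (s * q ^ (e * m)) := by
    intro m
    rw [mul_pow, hκ, map_mul, map_pow, ← pow_mul, mul_comm m e]
  set w : ℕ → L := fun m =>
    algebraMap k L (h.leadingCoeff.eval (s * q ^ (e * m))) * ζ (e * m) with hw
  have hw0 : ∀ m, (f.map ι).evalEval (algebraMap k L (s * q ^ (e * m))) (w m) = 0 := by
    intro m
    have h1 := Polynomial.integralNormalization_eval₂_leadingCoeff_mul (p := h) (by omega)
      ((Polynomial.evalRingHom (algebraMap k L (s * q ^ (e * m)))).comp ι) (ζ (e * m))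
    have h2 := hζ' (e * m)
    rw [← Polynomial.eval₂_evalRingHom, Polynomial.eval₂_map] at h2
    rw [h2, mul_zero] at h1
    rw [← Polynomial.eval₂_evalRingHom, Polynomial.eval₂_map, ← h1]
    refine congrArg (fun c => Polynomial.eval₂ _ (c * ζ (e * m)) f) ?_
    rw [RingHom.comp_apply, hι, Polynomial.coe_mapRingHom, Polynomial.coe_evalRingHom,
      Polynomial.eval_map, Polynomial.eval₂_at_apply]
  have hconj : ∀ m, ∃ w' : L, ∃ a b : k, w m + w' = algebraMap k L a ∧
      w m * w' = algebraMap k L b ∧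
      ∀ p : Polynomial k, Polynomial.aeval (w m) p = 0 → Polynomial.aeval w' p = 0 := by
    intro m
    obtain ⟨K, hKfin, hK2, hmem⟩ := hK (e * m)
    refine exists_conjugate_of_natDegree_minpoly_le_two
      (Algebra.IsIntegral.isIntegral _) (le_trans ?_ hK2)
    exact natDegree_minpoly_le_of_mem (K.mul_mem (K.algebraMap_mem _) hmem)
  choose w' a b ha hb hp using hconj
  have hw0' : ∀ m, (f.map ι).evalEval (algebraMap k L (s * q ^ (e * m))) (w' m) = 0 := by
    intro m
    have := hw0 m
    rw [hev] at this ⊢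
    exact hp m _ this
  obtain ⟨C, D, hCD⟩ := exists_sizeLE_of_evalEval_eq_zero hfmon (algebraMap k L s)
    (algebraMap k L q ^ e)
  have hsize : ∀ m w, (f.map ι).evalEval (algebraMap k L (s * q ^ (e * m))) w = 0 →
      SizeLE (C * D ^ m) w := by
    intro m w hmw
    refine hCD m w ?_
    rwa [← pow_mul, ← map_pow, ← map_mul]
  obtain ⟨φ, hφ, φ', -, A, B, hA, hB⟩ := exists_polynomial_pair hν hq0 hq hκ0 hfmon hΦ
    (z := w) (z' := w') (a := a) (b := b) (C := C) (D := D)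
    (fun m => by rw [hpow, hw0]) (fun m => by rw [hpow, hw0']) ha hb
    (fun m => hsize m _ (hw0 m)) (fun m => hsize m _ (hw0' m))
  refine hroot e he φ ?_ A B ?_
  · rw [hΦ, Polynomial.eval_multiset_prod]
    refine Multiset.prod_eq_zero ?_
    rw [Multiset.mem_map]
    exact ⟨_, Multiset.mem_map_of_mem _ hφ, by simp⟩
  · rw [← hA, ← hB]
    ring

theorem finite_setOf_eval_eq_zero {F : MvPolynomial (Fin 3) L} (hF : F.IsHomogeneous 4)
    (hsm : ∀ P : Fin 3 → L, P ≠ 0 → ∃ i, eval P (pderiv i F) ≠ 0) {x : L} (hx : x ≠ 0) (y : L) :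
    {z | eval ![x, y, z] F = 0}.Finite := by
  have h := exists_eval_ne_zero_of_smooth hF hsm (y / x)
  refine ((Polynomial.finite_setOfPred_isRoot h).preimage
    (f := fun z => z / x) fun z _ z' _ hz => ?_).subset fun z hz => ?_
  · simpa [hx] using hz
  · rw [Set.mem_ofPred_eq, eval_eq_of_isHomogeneous hF hx, mul_eq_zero,
      ← affinePart_evalEval] at hz
    change Polynomial.IsRoot _ _
    rw [Polynomial.IsRoot, Polynomial.map_evalRingHom_eval]
    exact hz.resolve_left (pow_ne_zero _ hx)

end Arithmetic

/-- **Quadratic geometric progressions on smooth plane curves of degree `4` are finite.**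
Let `C : F(X,Y,Z) = 0` be a smooth projective plane curve of degree `4` (a smooth plane quartic) over a number
field `k`.  Then there is no infinite quadratic geometric progression sequence on `C`:
there is no infinite sequence of pairwise distinct points `P i = (x i : 1 : z i)` on `C`,
each defined over an extension of `k` of degree at most `2` (i.e. lying in `Γ₂(C,k)`), whose
`x`-coordinates form a geometric progression `x i = t' * t ^ (i+1)` with `t, t' ∈ k*`. -/
theorem quadratic_geometric_progression_on_plane_quartic_is_finite
    (k : Type) [Field k] [NumberField k]
    (F : MvPolynomial (Fin 3) k) (hF : IsSmoothPlaneCurve 4 F)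
    (t t' : k) (ht : t ≠ 0) (ht' : t' ≠ 0)
    (P : ℕ → Fin 3 → AlgebraicClosure k) (hinj : Function.Injective P)
    (honC : ∀ i, eval (P i) (map (algebraMap k (AlgebraicClosure k)) F) = 0)
    (hx : ∀ i, P i 0 = algebraMap k (AlgebraicClosure k) (t' * t ^ (i + 1)))
    (hy : ∀ i, P i 1 = 1)
    (hquad : ∀ i,
      Module.finrank k (IntermediateField.adjoin k (Set.range (P i))) ≤ 2) :
    False := by
  have hsm : ∀ Q : Fin 3 → AlgebraicClosure k, Q ≠ 0 →
      ∃ i, eval Q (pderiv i (map (algebraMap k (AlgebraicClosure k)) F)) ≠ 0 := by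
    simpa only [pderiv_map] using hF.2
  have hF' := hF.1.map (algebraMap k (AlgebraicClosure k))
  have hP : ∀ i, P i = ![algebraMap k (AlgebraicClosure k) (t' * t ^ (i + 1)), 1, P i 2] := by
    intro i
    ext j
    fin_cases j
    · exact hx i
    · exact hy i
    · rfl
  have hx0 : ∀ i, algebraMap k (AlgebraicClosure k) (t' * t ^ (i + 1)) ≠ 0 := fun i => by
    rw [Ne, map_eq_zero]
    exact mul_ne_zero ht' (pow_ne_zero _ ht)
  by_cases hu : ∃ n : ℕ, 0 < n ∧ t ^ n = 1
  · obtain ⟨n, hn, hn1⟩ := hu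
    have hconst : ∀ j, t' * t ^ (n * j + 1) = t' * t := fun j => by
      rw [pow_succ, pow_mul, hn1, one_pow, one_mul]
    have h0 := hx0 (n * 0)
    rw [hconst] at h0
    refine Set.infinite_range_of_injective (f := fun j => P (n * j) 2) (fun i j hij => ?_)
      ((finite_setOf_eval_eq_zero hF' hsm h0 1).subset ?_)
    · have h1 : P (n * i) = P (n * j) := by
        rw [hP (n * i), hP (n * j), hconst, hconst]
        exact congrArg (fun z => ![_, 1, z]) hij
      exact Nat.eq_of_mul_eq_mul_left hn (hinj h1)
    · rintro _ ⟨j, rfl⟩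
      rw [Set.mem_ofPred_eq, ← hconst j, ← hP, honC]
  · push Not at hu
    obtain ⟨ν, hν, hν1⟩ := exists_isLiouvilleAbs_one_lt (L := AlgebraicClosure k) ht hu
    refine not_forall_quadratic_over_convergent_progression hF.1 hsm hν (s := (t' * t)⁻¹)
      (q := t⁻¹) (inv_ne_zero (mul_ne_zero ht' ht)) (inv_ne_zero ht) ?_
      (ζ := fun i => P i 2 / algebraMap k (AlgebraicClosure k) (t' * t ^ (i + 1)))
      (fun i => ?_) fun i => ?_
    · rw [map_inv₀, map_inv₀]
      exact inv_lt_one_of_one_lt₀ hν1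
    · have h := honC i
      rw [hP, eval_eq_of_isHomogeneous hF' (hx0 i)] at h
      have h1 := (mul_eq_zero.1 h).resolve_left (pow_ne_zero _ (hx0 i))
      rw [← h1, one_div, ← map_inv₀]
      have h2 : (t' * t)⁻¹ * t⁻¹ ^ i = (t' * t ^ (i + 1))⁻¹ := by
        rw [inv_pow, ← mul_inv, pow_succ', mul_assoc]
      rw [h2]
    · refine ⟨IntermediateField.adjoin k (Set.range (P i)),
        IntermediateField.finiteDimensional_adjoin fun x _ => Algebra.IsIntegral.isIntegral x,
        hquad i, ?_⟩
      exact div_mem (IntermediateField.subset_adjoin k _ ⟨2, rfl⟩)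
        (IntermediateField.algebraMap_mem _ _)
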